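/- arXiv:1710.00627 — 10 statements merged into one kernel-verified Lean document; each statement's English description precedes it below -/
import Mathlib

section
/- Let X be a locally compact zero-dimensional space, let S ⊆ Homeo(X) with 1 ∈ S and S = S⁻¹, such that S is equicontinuous with respect to some compatible uniformity, and let G = ⟨S⟩. Let U be an open subset of X, and write U* for the union of all compact G-invariant subsets of U. Then the following are equivalent: (i) U* is open in X and consists of S-recurrent points; (ii) U* is open in X and consists of almost periodic points for G; (iii) for every compact open subset V of U, the intersection ⋂_{g ∈ G} g(V) is open; (iv) given x ∈ U and y ∈ U* such that y ∈ closure(Gx), then x ∈ closure(Gy); (v) there is an open neighbourhood W of U* such that the G-orbit closure relation restricted to W × W is closed; (vi) U* is open in X and there is a G-equivariant quotient map φ: U* → Y, where Y is a locally compact zero-dimensional space such that G acts trivially on Y and minimally on each fibre of φ. -/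
open Filter Topology Set Pointwise Uniformity

namespace Reid

/-- The group of self-homeomorphisms of a space, with `(f * g) x = f (g x)`. -/
instance {X : Type*} [TopologicalSpace X] : Group (X ≃ₜ X) where
  mul f g := g.trans f
  one := Homeomorph.refl X
  inv := Homeomorph.symm
  mul_assoc f g h := Homeomorph.ext fun _ => rfl
  one_mul f := Homeomorph.ext fun _ => rfl
  mul_one f := Homeomorph.ext fun _ => rfl
  inv_mul_cancel f := Homeomorph.ext f.symm_apply_apply

/-- The tautological action of the homeomorphism group on the space. -/
instance {X : Type*} [TopologicalSpace X] : MulAction (X ≃ₜ X) X where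
  smul f x := f x
  one_smul _ := rfl
  mul_smul _ _ _ := rfl

/-- A topological space is zero-dimensional if it has a base of clopen sets
(Hausdorffness is imposed separately as an instance). -/
def ZeroDimensional (X : Type*) [TopologicalSpace X] : Prop :=
  ∃ B : Set (Set X), TopologicalSpace.IsTopologicalBasis B ∧ ∀ U ∈ B, IsClopen U

/-- A set `S` of homeomorphisms is equicontinuous at `x` with respect to a uniformity `u` on `X`
if for every entourage `E` there is a neighbourhood `U` of `x` such that `(s x, s y) ∈ E`
for all `s ∈ S` and `y ∈ U`. -/
def EquicontinuousAtPt {X : Type*} [TopologicalSpace X] (u : UniformSpace X)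
    (S : Set (X ≃ₜ X)) (x : X) : Prop :=
  ∀ E ∈ u.uniformity, ∃ U ∈ 𝓝 x, ∀ s ∈ S, ∀ y ∈ U, (s x, s y) ∈ E

/-- A set of homeomorphisms is equicontinuous if it is equicontinuous at every point. -/
def EquicontinuousSet {X : Type*} [TopologicalSpace X] (u : UniformSpace X)
    (S : Set (X ≃ₜ X)) : Prop :=
  ∀ x : X, EquicontinuousAtPt u S x

/-- The word length of `g` with respect to a generating set `S` with `1 ∈ S = S⁻¹`:
the least `n` with `g ∈ S ^ n`. -/
noncomputable def wordLen {G : Type*} [Group G] (S : Set G) (g : G) : ℕ :=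
  sInf {n : ℕ | g ∈ S ^ n}

/-- The set `K(g) = S^(|g|-1) g`. -/
def Kset {G : Type*} [Group G] (S : Set G) (g : G) : Set G :=
  S ^ (wordLen S g - 1) * {g}

/-- A net in `α`: a function to `α` from a nonempty directed preorder. -/
structure Net (α : Type u) : Type (u + 1) where
  ι : Type u
  str : Preorder ι
  directed : IsDirected ι fun a b => str.le a b
  nonempty : Nonempty ι
  toFun : ι → α

/-- The `atTop` filter on the index type of a net. -/
def Net.atTop {α : Type u} (N : Net α) : Filter N.ι :=
  @Filter.atTop N.ι N.str

/-- A point `x` is `S`-recurrent if for every net `(g_i)` in `G = ⟨S⟩` with `|g_i| → ∞` and every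
neighbourhood `U` of `x`, there are an integer `n`, a subnet `(g_{φ(j)})` and elements
`c_j ∈ K(g_{φ(j)})` with `c_j x ∈ U` and `|c_j| ≤ n` for all `j`. -/
def SRecurrent {X : Type u} [TopologicalSpace X] (S : Set (X ≃ₜ X)) (x : X) : Prop :=
  ∀ N : Net (X ≃ₜ X), (∀ i, N.toFun i ∈ Subgroup.closure S) →
    Filter.Tendsto (fun i => wordLen S (N.toFun i)) N.atTop Filter.atTop →
    ∀ U ∈ 𝓝 x,
      ∃ (n : ℕ) (M : Net (X ≃ₜ X)) (φ : M.ι → N.ι) (c : M.ι → (X ≃ₜ X)),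
        (∀ j, M.toFun j = N.toFun (φ j)) ∧
        Filter.Tendsto φ M.atTop N.atTop ∧
        ∀ j, c j ∈ Kset S (N.toFun (φ j)) ∧ (c j) x ∈ U ∧ wordLen S (c j) ≤ n

/-- A point `x` is almost periodic for `G` if for every neighbourhood `U` of `x`, setting
`N = {h ∈ G | h x ∈ U}`, there is a finite `F ⊆ G` with `F N = G`. -/
def AlmostPeriodicPt {X : Type*} [TopologicalSpace X] (G : Subgroup (X ≃ₜ X)) (x : X) : Prop :=
  ∀ U ∈ 𝓝 x, ∃ F : Finset (X ≃ₜ X), (F : Set (X ≃ₜ X)) ⊆ (G : Set (X ≃ₜ X)) ∧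
    ∀ g ∈ G, ∃ f ∈ F, (f⁻¹ * g) x ∈ U

section Topology

variable {X : Type*} [TopologicalSpace X]

theorem ZeroDimensional.exists_isCompact_isOpen_between [T2Space X] [LocallyCompactSpace X]
    (hzd : ZeroDimensional X) {K O : Set X} (hK : IsCompact K) (hO : IsOpen O) (hKO : K ⊆ O) :
    ∃ V, IsCompact V ∧ IsOpen V ∧ K ⊆ V ∧ V ⊆ O := by
  obtain ⟨B, hB, hBc⟩ := hzd
  refine hK.induction_on (p := fun s => ∃ V, IsCompact V ∧ IsOpen V ∧ s ⊆ V ∧ V ⊆ O)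
    ⟨∅, isCompact_empty, isOpen_empty, subset_rfl, empty_subset _⟩ ?_ ?_ ?_
  · rintro s t hst ⟨V, h1, h2, h3, h4⟩
    exact ⟨V, h1, h2, hst.trans h3, h4⟩
  · rintro s t ⟨V, h1, h2, h3, h4⟩ ⟨V', h1', h2', h3', h4'⟩
    exact ⟨V ∪ V', h1.union h1', h2.union h2', union_subset_union h3 h3', union_subset h4 h4'⟩
  · intro x hx
    obtain ⟨L, hL, hLO, hLc⟩ := local_compact_nhds (hO.mem_nhds (hKO hx))
    obtain ⟨C, hC, hxC, hCL⟩ := hB.mem_nhds_iff.1 hL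
    have hCc : IsClopen C := hBc C hC
    exact ⟨C, mem_nhdsWithin_of_mem_nhds (hCc.isOpen.mem_nhds hxC), C,
      hLc.of_isClosed_subset hCc.isClosed hCL, hCc.isOpen, subset_rfl, hCL.trans hLO⟩

theorem mem_closure_orbit_iff {G : Subgroup (X ≃ₜ X)} {x y : X} :
    y ∈ closure (MulAction.orbit G x) ↔ ∀ O, IsOpen O → y ∈ O → ∃ g ∈ G, g x ∈ O := by
  rw [mem_closure_iff]
  refine forall₃_congr fun O _ _ => ⟨?_, ?_⟩
  · rintro ⟨_, hz, ⟨g, rfl⟩⟩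
    exact ⟨g, g.2, hz⟩
  · rintro ⟨g, hg, hgx⟩
    exact ⟨g x, hgx, ⟨⟨g, hg⟩, rfl⟩⟩

theorem mem_closure_orbit_self {G : Subgroup (X ≃ₜ X)} (x : X) :
    x ∈ closure (MulAction.orbit G x) :=
  subset_closure (MulAction.mem_orbit_self x)

theorem apply_mem_closure_orbit {G : Subgroup (X ≃ₜ X)} {g : X ≃ₜ X} (hg : g ∈ G) (x : X) :
    g x ∈ closure (MulAction.orbit G x) :=
  subset_closure ⟨⟨g, hg⟩, rfl⟩

theorem mem_of_mem_closure_orbit {G : Subgroup (X ≃ₜ X)} {x y : X}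
    (h : y ∈ closure (MulAction.orbit G x)) {A : Set X} (hA : IsClosed A)
    (hx : ∀ g ∈ G, g x ∈ A) : y ∈ A := by
  refine closure_minimal ?_ hA h
  rintro _ ⟨g, rfl⟩
  exact hx g g.2

theorem mem_closure_orbit_trans {G : Subgroup (X ≃ₜ X)} {x y z : X}
    (h : y ∈ closure (MulAction.orbit G x)) (h' : z ∈ closure (MulAction.orbit G y)) :
    z ∈ closure (MulAction.orbit G x) := by
  rw [mem_closure_orbit_iff] at *
  intro O hO hz
  obtain ⟨g, hg, hgy⟩ := h' O hO hz
  obtain ⟨k, hk, hkx⟩ := h (g ⁻¹' O) (hO.preimage g.continuous) hgy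
  exact ⟨g * k, G.mul_mem hg hk, hkx⟩

theorem mem_closure_orbit_apply {G : Subgroup (X ≃ₜ X)} {g : X ≃ₜ X} (hg : g ∈ G) (x : X) :
    x ∈ closure (MulAction.orbit G (g x)) := by
  have := apply_mem_closure_orbit (G.inv_mem hg) (g x)
  rwa [show g⁻¹ (g x) = x from g.symm_apply_apply x] at this

/-- Almost periodic points with closed orbit closure in a regular space have minimal orbit
closures. -/
theorem AlmostPeriodicPt.mem_closure_orbit_symm [RegularSpace X] {G : Subgroup (X ≃ₜ X)} {x y : X}
    (hx : AlmostPeriodicPt G x) (hy : y ∈ closure (MulAction.orbit G x)) :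
    x ∈ closure (MulAction.orbit G y) := by
  rw [mem_closure_orbit_iff]
  intro O hO hxO
  obtain ⟨N, hN, hNc, hNO⟩ := exists_mem_nhds_isClosed_subset (hO.mem_nhds hxO)
  obtain ⟨F, hFG, hF⟩ := hx N hN
  have hcl : IsClosed (⋃ f ∈ F, (f⁻¹ : X ≃ₜ X) ⁻¹' N) :=
    F.finite_toSet.isClosed_biUnion fun f _ => hNc.preimage (f⁻¹ : X ≃ₜ X).continuous
  have := mem_of_mem_closure_orbit hy hcl fun g hg => by
    obtain ⟨f, hf, hfg⟩ := hF g hg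
    exact mem_biUnion hf hfg
  obtain ⟨f, hf, hfy⟩ := mem_iUnion₂.1 this
  exact ⟨f⁻¹, G.inv_mem (hFG hf), hNO hfy⟩

/-- Points in compact minimal sets are almost periodic. -/
theorem almostPeriodicPt_of_symm {G : Subgroup (X ≃ₜ X)} {x : X}
    (hc : IsCompact (closure (MulAction.orbit G x)))
    (h : ∀ y ∈ closure (MulAction.orbit G x), x ∈ closure (MulAction.orbit G y)) :
    AlmostPeriodicPt G x := by
  classical
  intro O hO
  obtain ⟨O', hO'O, hO', hxO'⟩ := mem_nhds_iff.1 hO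
  obtain ⟨t, ht⟩ := hc.elim_finite_subcover (fun g : G => ((g : X ≃ₜ X)⁻¹ : X ≃ₜ X) ⁻¹' O')
    (fun g => hO'.preimage ((g : X ≃ₜ X)⁻¹ : X ≃ₜ X).continuous) fun y hy => by
      obtain ⟨g, hg, hgy⟩ := mem_closure_orbit_iff.1 (h y hy) O' hO' hxO'
      refine mem_iUnion.2 ⟨⟨g⁻¹, G.inv_mem hg⟩, ?_⟩
      simpa using hgy
  refine ⟨t.image (↑), fun _ hf => ?_, fun g hg => ?_⟩
  · obtain ⟨f, -, rfl⟩ := Finset.mem_image.1 (Finset.mem_coe.1 hf)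
    exact f.2
  obtain ⟨f, hf, hfg⟩ := mem_iUnion₂.1 (ht (apply_mem_closure_orbit hg x))
  exact ⟨f, Finset.mem_image_of_mem _ hf, hO'O hfg⟩

end Topology

section WordLength

variable {G : Type*} [Group G] {S : Set G}

theorem exists_mem_pow_of_mem_closure (hSinv : S⁻¹ = S) {g : G}
    (hg : g ∈ Subgroup.closure S) : ∃ n, g ∈ S ^ n := by
  induction hg using Subgroup.closure_induction with
  | mem x hx => exact ⟨1, by simpa using hx⟩
  | one => exact ⟨0, by simp⟩
  | mul x y _ _ hx hy =>
    obtain ⟨m, hm⟩ := hx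
    obtain ⟨n, hn⟩ := hy
    exact ⟨m + n, by rw [pow_add]; exact mul_mem_mul hm hn⟩
  | inv x _ hx =>
    obtain ⟨n, hn⟩ := hx
    exact ⟨n, by rwa [← hSinv, inv_pow, Set.inv_mem_inv]⟩

theorem mem_closure_of_mem_pow {n : ℕ} {g : G} (hg : g ∈ S ^ n) : g ∈ Subgroup.closure S := by
  induction n generalizing g with
  | zero => simp_all
  | succ n ih =>
    rw [pow_succ] at hg
    obtain ⟨a, ha, b, hb, rfl⟩ := hg
    exact mul_mem (ih ha) (Subgroup.subset_closure hb)

theorem inv_mem_pow (hSinv : S⁻¹ = S) {n : ℕ} {g : G} (hg : g ∈ S ^ n) : g⁻¹ ∈ S ^ n := by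
  rwa [← hSinv, inv_pow, Set.inv_mem_inv]

theorem wordLen_le {n : ℕ} {g : G} (hg : g ∈ S ^ n) : wordLen S g ≤ n :=
  Nat.sInf_le hg

theorem mem_pow_wordLen (hSinv : S⁻¹ = S) {g : G} (hg : g ∈ Subgroup.closure S) :
    g ∈ S ^ wordLen S g :=
  Nat.sInf_mem (exists_mem_pow_of_mem_closure hSinv hg)

end WordLength

/-- The points of `X` sent into `V` by every word of length at most `n` in `S`. -/
def wordCore {X : Type*} [TopologicalSpace X] (S : Set (X ≃ₜ X)) (V : Set X) (n : ℕ) : Set X :=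
  {x | ∀ g ∈ S ^ n, g x ∈ V}

/-- The largest `G`-invariant subset of `V`. -/
def invCore {X : Type*} [TopologicalSpace X] (G : Subgroup (X ≃ₜ X)) (V : Set X) : Set X :=
  {x | ∀ g ∈ G, g x ∈ V}

/-- Whether an element of `S` sends a point into the set `V` is locally constant in the point,
uniformly over `S`, for every compact open `V`. -/
def LocallyUniform {X : Type*} [TopologicalSpace X] (S : Set (X ≃ₜ X)) : Prop :=
  ∀ V : Set X, IsCompact V → IsOpen V → ∀ x, ∀ᶠ y in 𝓝 x, ∀ s ∈ S, s x ∈ V ↔ s y ∈ V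

theorem EquicontinuousSet.locallyUniform {X : Type*} [u : UniformSpace X] {S : Set (X ≃ₜ X)}
    (hS : EquicontinuousSet u S) : LocallyUniform S := by
  intro V hVc hVo x
  obtain ⟨E, hE, -, hEV⟩ := lebesgue_number_of_compact_open hVc hVo subset_rfl
  obtain ⟨E', hE', hsymm, hEE⟩ := symm_of_uniformity hE
  obtain ⟨N, hN, hNE⟩ := hS x E' hE'
  filter_upwards [hN] with y hy s hs
  exact ⟨fun h => hEV _ h (hEE (hNE s hs y hy)),
    fun h => hEV _ h (hEE (hsymm.symm _ _ (hNE s hs y hy)))⟩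

section Core

variable {X : Type*} [TopologicalSpace X] {S : Set (X ≃ₜ X)} {G : Subgroup (X ≃ₜ X)} {V : Set X}

theorem biInter_image_eq_invCore (G : Subgroup (X ≃ₜ X)) (V : Set X) :
    (⋂ g ∈ G, (g : X ≃ₜ X) '' V) = invCore G V := by
  ext x
  simp only [mem_iInter, invCore, mem_ofPred_eq]
  refine ⟨fun h g hg => ?_, fun h g hg => ⟨g⁻¹ x, h _ (G.inv_mem hg), g.apply_symm_apply x⟩⟩
  obtain ⟨y, hy, hyx⟩ := h g⁻¹ (G.inv_mem hg)
  rw [← hyx]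
  rwa [show g (g⁻¹ y) = y from g.apply_symm_apply y]

theorem invCore_subset : invCore G V ⊆ V := fun _ hx => hx 1 G.one_mem

theorem apply_mem_invCore {g : X ≃ₜ X} (hg : g ∈ G) {x : X} (hx : x ∈ invCore G V) :
    g x ∈ invCore G V :=
  fun k hk => hx (k * g) (G.mul_mem hk hg)

theorem mem_invCore_of_apply {g : X ≃ₜ X} (hg : g ∈ G) {x : X} (hx : g x ∈ invCore G V) :
    x ∈ invCore G V := by
  have := apply_mem_invCore (G.inv_mem hg) hx
  rwa [show g⁻¹ (g x) = x from g.symm_apply_apply x] at this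

theorem image_invCore {g : X ≃ₜ X} (hg : g ∈ G) : g '' invCore G V = invCore G V := by
  refine subset_antisymm (image_subset_iff.2 fun x hx => apply_mem_invCore hg hx) fun x hx => ?_
  exact ⟨g⁻¹ x, apply_mem_invCore (G.inv_mem hg) hx, g.apply_symm_apply x⟩

theorem isClosed_invCore (hV : IsClosed V) : IsClosed (invCore G V) := by
  simp only [invCore, ofPred_forall]
  exact isClosed_biInter fun g _ => hV.preimage g.continuous

theorem isCompact_invCore [T2Space X] (hV : IsCompact V) : IsCompact (invCore G V) :=
  hV.of_isClosed_subset (isClosed_invCore hV.isClosed) invCore_subset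

theorem mem_invCore_of_mem_closure_orbit (hV : IsClosed V) {x y : X} (hx : x ∈ invCore G V)
    (hy : y ∈ closure (MulAction.orbit G x)) : y ∈ invCore G V :=
  mem_of_mem_closure_orbit hy (isClosed_invCore hV) fun _ hg => apply_mem_invCore hg hx

theorem mem_invCore_of_isOpen (hV : IsOpen (invCore G V)) {x y : X} (hy : y ∈ invCore G V)
    (hxy : y ∈ closure (MulAction.orbit G x)) : x ∈ invCore G V := by
  obtain ⟨g, hg, hgx⟩ := mem_closure_orbit_iff.1 hxy _ hV hy
  exact mem_invCore_of_apply hg hgx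

theorem wordCore_zero : wordCore S V 0 = V := by
  ext x
  simp only [wordCore, pow_zero, Set.mem_one, forall_eq]
  rfl

theorem apply_mem_wordCore {i j : ℕ} {h : X ≃ₜ X} (hh : h ∈ S ^ j) {x : X}
    (hx : x ∈ wordCore S V (i + j)) : h x ∈ wordCore S V i :=
  fun g hg => hx (g * h) (by rw [pow_add]; exact mul_mem_mul hg hh)

theorem mem_wordCore_succ {n : ℕ} {x : X} :
    x ∈ wordCore S V (n + 1) ↔ ∀ s ∈ S, s x ∈ wordCore S V n := by
  refine ⟨fun h s hs => apply_mem_wordCore (by simpa using hs) h, fun h g hg => ?_⟩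
  rw [pow_succ] at hg
  obtain ⟨a, ha, b, hb, rfl⟩ := hg
  exact h b hb a ha

theorem wordCore_antitone (hS1 : 1 ∈ S) : Antitone (wordCore S V) :=
  fun _ _ hmn _ hx g hg => hx g (Set.pow_subset_pow_right hS1 hmn hg)

theorem wordCore_subset (hS1 : 1 ∈ S) (n : ℕ) : wordCore S V n ⊆ V := by
  simpa only [wordCore_zero] using wordCore_antitone (V := V) hS1 (Nat.zero_le n)

theorem invCore_eq_iInter_wordCore (hSinv : S⁻¹ = S) (hSgen : Subgroup.closure S = G) :
    invCore G V = ⋂ n, wordCore S V n := by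
  subst hSgen
  ext x
  refine ⟨fun h => mem_iInter.2 fun n g hg => h g (mem_closure_of_mem_pow hg), fun h g hg => ?_⟩
  obtain ⟨n, hn⟩ := exists_mem_pow_of_mem_closure hSinv hg
  exact mem_iInter.1 h n g hn

theorem isCompact_isOpen_wordCore [T2Space X] (hS1 : 1 ∈ S) (hA : LocallyUniform S)
    (hVc : IsCompact V) (hVo : IsOpen V) (n : ℕ) :
    IsCompact (wordCore S V n) ∧ IsOpen (wordCore S V n) := by
  induction n with
  | zero => rw [wordCore_zero]; exact ⟨hVc, hVo⟩
  | succ n ih =>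
    constructor
    · refine ih.1.of_isClosed_subset ?_ (wordCore_antitone hS1 n.le_succ)
      simp only [wordCore, ofPred_forall]
      exact isClosed_biInter fun g _ => hVc.isClosed.preimage g.continuous
    · rw [isOpen_iff_mem_nhds]
      intro x hx
      filter_upwards [hA _ ih.1 ih.2 x] with y hy
      exact mem_wordCore_succ.2 fun s hs => (hy s hs).1 (mem_wordCore_succ.1 hx s hs)

theorem isClopen_setOf_exists_mem (hA : LocallyUniform S) (hVc : IsCompact V) (hVo : IsOpen V) :
    IsClopen {x | ∃ s ∈ S, s x ∈ V} := by
  constructor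
  · rw [← isOpen_compl_iff, isOpen_iff_mem_nhds]
    intro x hx
    filter_upwards [hA _ hVc hVo x] with y hy
    rintro ⟨s, hs, hsy⟩
    exact hx ⟨s, hs, (hy s hs).2 hsy⟩
  · rw [isOpen_iff_mem_nhds]
    rintro x ⟨s, hs, hsx⟩
    filter_upwards [hA _ hVc hVo x] with y hy
    exact ⟨s, hs, (hy s hs).1 hsx⟩

theorem isClosed_setOf_exists_mem_wordCore [T2Space X] (hS1 : 1 ∈ S) (hSinv : S⁻¹ = S)
    (hA : LocallyUniform S) (hVc : IsCompact V) (hVo : IsOpen V) (n : ℕ) :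
    IsClosed {x | ∃ h ∈ S ^ n, h x ∈ wordCore S V n} := by
  have key : ∀ j ≤ n, IsCompact {x | ∃ h ∈ S ^ j, h x ∈ wordCore S V n} ∧
      IsOpen {x | ∃ h ∈ S ^ j, h x ∈ wordCore S V n} := by
    intro j
    induction j with
    | zero =>
      intro _
      have : {x | ∃ h ∈ S ^ 0, h x ∈ wordCore S V n} = wordCore S V n := by
        ext x
        simp only [pow_zero, Set.mem_one, exists_eq_left]
        rfl
      rw [this]
      exact isCompact_isOpen_wordCore hS1 hA hVc hVo n
    | succ j ih =>
      intro hj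
      obtain ⟨hc, ho⟩ := ih (by omega)
      have hcl := isClopen_setOf_exists_mem hA hc ho
      have heq : {x | ∃ h ∈ S ^ (j + 1), h x ∈ wordCore S V n} =
          {x | ∃ s ∈ S, s x ∈ {x | ∃ h ∈ S ^ j, h x ∈ wordCore S V n}} := by
        ext x
        simp only [pow_succ, mem_ofPred_eq]
        constructor
        · rintro ⟨_, ⟨a, ha, b, hb, rfl⟩, hx⟩
          exact ⟨b, hb, a, ha, hx⟩
        · rintro ⟨b, hb, a, ha, hx⟩
          exact ⟨a * b, mul_mem_mul ha hb, hx⟩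
      rw [← heq] at hcl
      refine ⟨hVc.of_isClosed_subset hcl.isClosed ?_, hcl.isOpen⟩
      rintro x ⟨h, hh, hx⟩
      have hx' : h x ∈ wordCore S V (0 + (j + 1)) :=
        wordCore_antitone hS1 (by omega) hx
      have := apply_mem_wordCore (inv_mem_pow hSinv hh) hx'
      rwa [wordCore_zero, show h⁻¹ (h x) = x from h.symm_apply_apply x] at this
  exact (key n le_rfl).1.isClosed

/-- If the invariant core of a compact open set `V` is not open, then some point which an element
of `S` moves out of `V` can be brought arbitrarily deep into `V` along words of increasing
length. -/
theorem exists_escaping_point [T2Space X] (hS1 : 1 ∈ S) (hSinv : S⁻¹ = S)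
    (hSgen : Subgroup.closure S = G) (hA : LocallyUniform S) (hVc : IsCompact V) (hVo : IsOpen V)
    (hV : ¬ IsOpen (invCore G V)) :
    ∃ z ∈ V, z ∉ wordCore S V 1 ∧ ∀ n, ∃ h ∈ S ^ n, h z ∈ wordCore S V n := by
  have hne : ∀ n, ∃ x ∈ wordCore S V n, x ∉ wordCore S V (n + 1) := by
    intro n
    by_contra! hn
    apply hV
    have : ∀ m, wordCore S V n ⊆ wordCore S V (n + m) := by
      intro m
      induction m with
      | zero => exact subset_rfl
      | succ m ih =>
        intro x hx
        refine mem_wordCore_succ.2 fun s hs => ih ?_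
        exact mem_wordCore_succ.1 (hn x hx) s hs
    have heq : invCore G V = wordCore S V n := by
      rw [invCore_eq_iInter_wordCore hSinv hSgen]
      refine subset_antisymm (iInter_subset _ n) (subset_iInter fun m => (this m).trans ?_)
      exact wordCore_antitone hS1 (by omega)
    rw [heq]
    exact (isCompact_isOpen_wordCore hS1 hA hVc hVo n).2
  let E : ℕ → Set X := fun n =>
    (V \ wordCore S V 1) ∩ {x | ∃ h ∈ S ^ n, h x ∈ wordCore S V n}
  have hEcl : ∀ n, IsClosed (E n) := fun n =>
    (hVc.isClosed.sdiff (isCompact_isOpen_wordCore hS1 hA hVc hVo 1).2).inter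
      (isClosed_setOf_exists_mem_wordCore hS1 hSinv hA hVc hVo n)
  obtain ⟨z, hz⟩ := IsCompact.nonempty_iInter_of_sequence_nonempty_isCompact_isClosed E
    (fun n => by
      rintro x ⟨hx, h, hh, hhx⟩
      refine ⟨hx, ?_⟩
      rw [pow_succ'] at hh
      obtain ⟨s, hs, k, hk, rfl⟩ := hh
      refine ⟨k, hk, ?_⟩
      have := mem_wordCore_succ.1 hhx s⁻¹ (by rwa [← hSinv, Set.inv_mem_inv])
      rwa [show s⁻¹ ((s * k) x) = k x from s.symm_apply_apply (k x)] at this)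
    (fun n => by
      obtain ⟨x, hx, hx'⟩ := hne n
      simp only [wordCore, mem_ofPred_eq, not_forall] at hx'
      obtain ⟨g, hg, hgx⟩ := hx'
      rw [pow_succ'] at hg
      obtain ⟨s, hs, h, hh, rfl⟩ := hg
      refine ⟨h x, ⟨hx h hh, fun hc => hgx (hc s (by simpa using hs))⟩, h⁻¹,
        inv_mem_pow hSinv hh, ?_⟩
      rwa [show h⁻¹ (h x) = x from h.symm_apply_apply x])
    (hVc.of_isClosed_subset (hEcl 0) fun x hx => hx.1.1) hEcl
  rw [mem_iInter] at hz
  exact ⟨z, (hz 0).1.1, (hz 0).1.2, fun n => (hz n).2⟩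

theorem notMem_invCore_of_notMem_wordCore (hSinv : S⁻¹ = S) (hSgen : Subgroup.closure S = G)
    {n : ℕ} {z : X} (hz : z ∉ wordCore S V n) : z ∉ invCore G V := fun h => by
  rw [invCore_eq_iInter_wordCore hSinv hSgen] at h
  exact hz (mem_iInter.1 h n)

theorem exists_mem_invCore_mem_closure_orbit [T2Space X] (hS1 : 1 ∈ S) (hSinv : S⁻¹ = S)
    (hSgen : Subgroup.closure S = G) (hA : LocallyUniform S) (hVc : IsCompact V) (hVo : IsOpen V)
    {z : X} (hz : ∀ n, ∃ h ∈ S ^ n, h z ∈ wordCore S V n) :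
    ∃ y ∈ invCore G V, y ∈ closure (MulAction.orbit G z) := by
  have hcl : ∀ n, IsClosed (wordCore S V n ∩ closure (MulAction.orbit G z)) := fun n =>
    (isCompact_isOpen_wordCore hS1 hA hVc hVo n).1.isClosed.inter isClosed_closure
  obtain ⟨y, hy⟩ := IsCompact.nonempty_iInter_of_sequence_nonempty_isCompact_isClosed
    (fun n => wordCore S V n ∩ closure (MulAction.orbit G z))
    (fun n => inter_subset_inter_left _ (wordCore_antitone hS1 n.le_succ))
    (fun n => by
      obtain ⟨h, hh, hhz⟩ := hz n
      exact ⟨h z, hhz, apply_mem_closure_orbit (hSgen ▸ mem_closure_of_mem_pow hh) z⟩)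
    (hVc.of_isClosed_subset (hcl 0) fun x hx => wordCore_subset hS1 0 hx.1) hcl
  rw [mem_iInter] at hy
  refine ⟨y, ?_, (hy 0).2⟩
  rw [invCore_eq_iInter_wordCore hSinv hSgen]
  exact mem_iInter.2 fun n => (hy n).1

end Core

theorem AlmostPeriodicPt.sRecurrent {X : Type u} [TopologicalSpace X] {S : Set (X ≃ₜ X)}
    (hS1 : 1 ∈ S) (hSinv : S⁻¹ = S) {x : X}
    (hx : AlmostPeriodicPt (Subgroup.closure S) x) : SRecurrent S x := by
  intro N hN htend O hO
  obtain ⟨F, hFG, hF⟩ := hx O hO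
  let m : ℕ := F.sup (wordLen S)
  have hFm : ∀ f ∈ F, f ∈ S ^ m := fun f hf =>
    Set.pow_subset_pow_right hS1 (Finset.le_sup hf) (mem_pow_wordLen hSinv (hFG hf))
  have key : ∀ g ∈ Subgroup.closure S, m + 1 ≤ wordLen S g →
      ∃ c ∈ Kset S g, c x ∈ O ∧ wordLen S c ≤ m + (m + 1) := by
    intro g hg hlen
    have hgw := mem_pow_wordLen hSinv hg
    obtain ⟨k, hk⟩ := Nat.exists_eq_add_of_le' hlen
    rw [hk, pow_add] at hgw
    obtain ⟨a, ha, p, hp, hap⟩ := hgw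
    obtain ⟨f, hf, hfp⟩ := hF p (mem_closure_of_mem_pow hp)
    refine ⟨f⁻¹ * p, ?_, hfp, wordLen_le ?_⟩
    · refine ⟨f⁻¹ * a⁻¹, ?_, g, rfl, ?_⟩
      · rw [hk, show k + (m + 1) - 1 = m + k by omega, pow_add]
        exact mul_mem_mul (inv_mem_pow hSinv (hFm f hf)) (inv_mem_pow hSinv ha)
      · rw [← hap]
        simp [mul_assoc]
    · rw [pow_add]
      exact mul_mem_mul (inv_mem_pow hSinv (hFm f hf)) hp
  let _ := N.str
  have := N.directed
  have := N.nonempty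
  have hev := htend.eventually_ge_atTop (m + 1)
  obtain ⟨i₀, hi₀⟩ : ∃ i₀, ∀ i ≥ i₀, m + 1 ≤ wordLen S (N.toFun i) := eventually_atTop.1 hev
  choose c hc using fun i : {i : N.ι // i₀ ≤ i} => key (N.toFun i) (hN i) (hi₀ i i.2)
  refine ⟨m + (m + 1), ⟨{i : N.ι // i₀ ≤ i}, inferInstance, ⟨fun a b => ?_⟩, ⟨⟨i₀, le_rfl⟩⟩,
    fun i => N.toFun i⟩, Subtype.val, c, fun _ => rfl, ?_, hc⟩
  · obtain ⟨d, hd⟩ := directed_of (· ≤ ·) a.1 b.1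
    exact ⟨⟨d, a.2.trans hd.1⟩, hd⟩
  · refine tendsto_atTop.2 fun b => ?_
    obtain ⟨d, hd⟩ := directed_of (· ≤ ·) i₀ b
    exact (eventually_ge_atTop (⟨d, hd.1⟩ : {i : N.ι // i₀ ≤ i})).mono fun i hi => hd.2.trans hi

/-- A recurrent point cannot escape a compact open set in the manner of
`exists_escaping_point`. -/
theorem SRecurrent.mem_wordCore_one {X : Type u} [TopologicalSpace X] [T2Space X]
    {S : Set (X ≃ₜ X)} (hS1 : 1 ∈ S) (hSinv : S⁻¹ = S) (hA : LocallyUniform S) {V : Set X}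
    (hVc : IsCompact V) (hVo : IsOpen V) {z : X} (hz : SRecurrent S z) (hzV : z ∈ V)
    (h : ∀ n, ∃ h ∈ S ^ n, h z ∈ wordCore S V n) : z ∈ wordCore S V 1 := by
  by_contra hz1
  choose a ha haz using h
  have hlen : ∀ n, wordLen S (a n) = n := by
    intro n
    refine le_antisymm (wordLen_le (ha n)) ?_
    by_contra! hlt
    have hmem := mem_pow_wordLen hSinv (mem_closure_of_mem_pow (ha n))
    have := apply_mem_wordCore (i := 1) (inv_mem_pow hSinv hmem)
      (wordCore_antitone hS1 (by omega : 1 + wordLen S (a n) ≤ n) (haz n))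
    rw [show (a n)⁻¹ (a n z) = z from (a n).symm_apply_apply z] at this
    exact hz1 this
  have hO : V \ wordCore S V 1 ∈ 𝓝 z := (hVo.sdiff
    (isCompact_isOpen_wordCore hS1 hA hVc hVo 1).1.isClosed).mem_nhds ⟨hzV, hz1⟩
  obtain ⟨n, M, φ, c, -, -, hc⟩ := hz
    ⟨ULift ℕ, inferInstance, ⟨fun i j => ⟨⟨i.down + j.down + 1⟩, by
      constructor <;> refine ULift.down_le.1 ?_ <;> dsimp <;> omega⟩⟩, ⟨⟨0⟩⟩,
      fun i => a (i.down + 1)⟩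
    (fun i => mem_closure_of_mem_pow (ha _))
    (by
      refine tendsto_atTop.2 fun b => ?_
      refine (eventually_ge_atTop (⟨b⟩ : ULift ℕ)).mono fun i hi => ?_
      have : b ≤ i.down := hi
      dsimp only
      rw [hlen]
      omega)
    _ hO
  obtain ⟨j⟩ := M.nonempty
  obtain ⟨⟨b, hb, _, rfl, hbc⟩, hcz, -⟩ := hc j
  dsimp only at hb hbc
  rw [hlen, Nat.add_sub_cancel] at hb
  refine hcz.2 ?_
  rw [← hbc]
  exact apply_mem_wordCore hb (by rw [add_comm 1]; exact haz _)

section InvariantPart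

variable {X : Type u} [TopologicalSpace X] [T2Space X]
  {G : Subgroup (X ≃ₜ X)} {U : Set X}

/-- The union of the invariant cores of the compact open subsets of `U`. -/
theorem sUnion_invariant_eq [LocallyCompactSpace X] (hzd : ZeroDimensional X) (hU : IsOpen U) :
    ⋃₀ {K : Set X | K ⊆ U ∧ IsCompact K ∧ ∀ g ∈ G, (g : X ≃ₜ X) '' K = K} =
      ⋃₀ (invCore G '' {V | V ⊆ U ∧ IsCompact V ∧ IsOpen V}) := by
  refine subset_antisymm (sUnion_subset ?_) (sUnion_subset ?_)
  · rintro K ⟨hKU, hKc, hK⟩ x hx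
    obtain ⟨V, hVc, hVo, hKV, hVU⟩ := hzd.exists_isCompact_isOpen_between hKc hU hKU
    refine ⟨_, ⟨V, ⟨hVU, hVc, hVo⟩, rfl⟩, fun g hg => hKV ?_⟩
    rw [← hK g hg]
    exact mem_image_of_mem _ hx
  · rintro _ ⟨V, ⟨hVU, hVc, -⟩, rfl⟩
    exact subset_sUnion_of_mem
      ⟨invCore_subset.trans hVU, isCompact_invCore hVc, fun g hg => image_invCore hg⟩

/-- If the invariant cores of compact open sets are open, compact orbit closures have arbitrarily
small invariant compact open neighbourhoods. -/
theorem exists_isOpen_invCore_of_subset [LocallyCompactSpace X] (hzd : ZeroDimensional X)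
    (h3 : ∀ V ⊆ U, IsCompact V → IsOpen V → IsOpen (invCore G V)) {x : X}
    (hc : IsCompact (closure (MulAction.orbit G x))) {O : Set X} (hO : IsOpen O) (hOU : O ⊆ U)
    (hxO : closure (MulAction.orbit G x) ⊆ O) :
    ∃ V ⊆ O, IsCompact V ∧ IsOpen (invCore G V) ∧ x ∈ invCore G V := by
  obtain ⟨V, hVc, hVo, hxV, hVO⟩ := hzd.exists_isCompact_isOpen_between hc hO hxO
  exact ⟨V, hVO, hVc, h3 V (hVO.trans hOU) hVc hVo,
    fun g hg => hxV (apply_mem_closure_orbit hg x)⟩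

/-- If `P` is an open set of points with compact orbit closures which have bases of invariant
compact open neighbourhoods in `P`, the space of orbit closures in `P` is a locally compact
zero-dimensional quotient. -/
theorem exists_quotient_of_invCore {P : Set X} (hP : IsOpen P)
    (hsymm : ∀ x ∈ P, ∀ y ∈ P, y ∈ closure (MulAction.orbit G x) →
      x ∈ closure (MulAction.orbit G y))
    (hcl : ∀ x ∈ P, closure (MulAction.orbit G x) ⊆ P)
    (hbase : ∀ x ∈ P, ∀ O, IsOpen O → closure (MulAction.orbit G x) ⊆ O →
      ∃ V ⊆ O ∩ P, IsCompact V ∧ IsOpen (invCore G V) ∧ x ∈ invCore G V) :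
    ∃ (Y : Type u) (tY : TopologicalSpace Y),
      @T2Space Y tY ∧ @LocallyCompactSpace Y tY ∧ @ZeroDimensional Y tY ∧
      ∃ φ : ↥P → Y, @Topology.IsQuotientMap ↥P Y _ tY φ ∧
        (∀ g ∈ G, ∀ (a : ↥P) (ha : (g : X ≃ₜ X) (a : X) ∈ P),
          φ ⟨(g : X ≃ₜ X) (a : X), ha⟩ = φ a) ∧
        ∀ a b : ↥P, φ a = φ b → (b : X) ∈ closure (MulAction.orbit G (a : X)) := by
  let r : Setoid P :=
    { r := fun a b => (b : X) ∈ closure (MulAction.orbit G (a : X))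
      iseqv := ⟨fun a => mem_closure_orbit_self _, fun {a b} h => hsymm a a.2 b b.2 h,
        fun h h' => mem_closure_orbit_trans h h'⟩ }
  let π : P → Quotient r := Quotient.mk r
  have hπ : ∀ a b, π a = π b ↔ (b : X) ∈ closure (MulAction.orbit G (a : X)) :=
    fun a b => Quotient.eq (r := r)
  have hπq : IsQuotientMap π := isQuotientMap_quotient_mk'
  have hpre : ∀ V, IsClosed V → IsOpen (invCore G V) →
      π ⁻¹' (π '' (Subtype.val ⁻¹' invCore G V)) = Subtype.val ⁻¹' invCore G V := by
    intro V hV hVo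
    refine subset_antisymm ?_ (subset_preimage_image _ _)
    rintro a ⟨b, hb, hba⟩
    exact mem_invCore_of_mem_closure_orbit hV hb ((hπ b a).1 hba)
  have hclopen : ∀ V, IsClosed V → IsOpen (invCore G V) →
      IsClopen (π '' (Subtype.val ⁻¹' invCore G V)) := by
    intro V hV hVo
    rw [← hπq.isClopen_preimage, hpre V hV hVo]
    exact ⟨(isClosed_invCore hV).preimage continuous_subtype_val,
      hVo.preimage continuous_subtype_val⟩
  have hnhds : ∀ (a : P) (O : Set (Quotient r)), IsOpen O → π a ∈ O →
      ∃ C ⊆ O, IsCompact C ∧ IsClopen C ∧ π a ∈ C := by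
    intro a O hO haO
    have hO' : IsOpen (Subtype.val '' (π ⁻¹' O)) :=
      hP.isOpenMap_subtype_val _ (hO.preimage hπq.continuous)
    obtain ⟨V, hVO, hVc, hVo, haV⟩ := hbase a a.2 _ hO' fun y hy =>
      ⟨⟨y, hcl a a.2 hy⟩, by rwa [mem_preimage, ← (hπ a ⟨y, hcl a a.2 hy⟩).2 hy], rfl⟩
    refine ⟨_, ?_, ?_, hclopen V hVc.isClosed hVo, mem_image_of_mem _ haV⟩
    · rintro _ ⟨b, hb, rfl⟩
      obtain ⟨b', hb', hbb⟩ := (hVO (invCore_subset hb)).1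
      rwa [← Subtype.ext hbb]
    · refine IsCompact.image ?_ hπq.continuous
      rw [Subtype.isCompact_iff, Subtype.image_preimage_coe, inter_eq_right.2]
      · exact isCompact_invCore hVc
      · exact fun y hy => (hVO (invCore_subset hy)).2
  refine ⟨Quotient r, inferInstance, ⟨?_⟩, ⟨?_⟩,
    ⟨{C | IsClopen C}, TopologicalSpace.isTopologicalBasis_of_isOpen_of_nhds
      (fun C hC => hC.isOpen) ?_, fun C hC => hC⟩, π, hπq, ?_, fun a b => (hπ a b).1⟩
  · intro p q hpq
    obtain ⟨a, rfl⟩ := hπq.surjective p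
    obtain ⟨b, rfl⟩ := hπq.surjective q
    have hb : (b : X) ∉ closure (MulAction.orbit G (a : X)) := fun h => hpq ((hπ a b).2 h)
    obtain ⟨V, hVO, hVc, hVo, haV⟩ := hbase a a.2 {(b : X)}ᶜ isOpen_compl_singleton
      fun y hy hyb => hb (hyb ▸ hy)
    have hC := hclopen V hVc.isClosed hVo
    refine ⟨_, _, hC.isOpen, hC.compl.isOpen, mem_image_of_mem _ haV, fun h => ?_,
      disjoint_compl_right⟩
    have hbV : b ∈ π ⁻¹' (π '' (Subtype.val ⁻¹' invCore G V)) := h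
    rw [hpre V hVc.isClosed hVo] at hbV
    exact (hVO (invCore_subset hbV)).1 rfl
  · intro p n hn
    obtain ⟨a, rfl⟩ := hπq.surjective p
    obtain ⟨O, hOn, hO, haO⟩ := mem_nhds_iff.1 hn
    obtain ⟨C, hCO, hCc, hC, haC⟩ := hnhds a O hO haO
    exact ⟨C, hC.isOpen.mem_nhds haC, hCO.trans hOn, hCc⟩
  · intro p O hp hO
    obtain ⟨a, rfl⟩ := hπq.surjective p
    obtain ⟨C, hCO, -, hC, haC⟩ := hnhds a O hO hp
    exact ⟨C, hC, haC, hCO⟩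
  · intro g hg a ha
    exact (hπ _ _).2 (mem_closure_orbit_apply hg _)

end InvariantPart

/-- Theorem 1.4: for `S` equicontinuous with respect to some compatible uniformity on a locally
compact zero-dimensional space `X`, with `1 ∈ S = S⁻¹`, `G = ⟨S⟩`, `U ⊆ X` open and `U*` the
union of all compact `G`-invariant subsets of `U`, the following are equivalent:
(i) `U*` is open and consists of `S`-recurrent points;
(ii) `U*` is open and consists of almost periodic points for `G`;
(iii) for every compact open `V ⊆ U`, the set `⋂_{g ∈ G} g(V)` is open;
(iv) for `x ∈ U` and `y ∈ U*` with `y ∈ closure (G x)`, we have `x ∈ closure (G y)`;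
(v) there is an open neighbourhood `W` of `U*` such that the orbit closure relation restricted
to `W × W` is closed;
(vi) `U*` is open and there is a `G`-equivariant quotient map `φ : U* → Y` with `Y` locally
compact zero-dimensional, `G` acting trivially on `Y` and minimally on each fibre of `φ`. -/
theorem AGW_generalized {X : Type u} [TopologicalSpace X] [T2Space X] [LocallyCompactSpace X]
    (hzd : ZeroDimensional X)
    (S : Set (X ≃ₜ X)) (hS1 : 1 ∈ S) (hSinv : S⁻¹ = S)
    (G : Subgroup (X ≃ₜ X)) (hSgen : Subgroup.closure S = G)
    (hequi : ∃ u : UniformSpace X, u.toTopologicalSpace = ‹TopologicalSpace X› ∧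
      EquicontinuousSet u S)
    (U : Set X) (hU : IsOpen U)
    (Ustar : Set X)
    (hUstar : Ustar = ⋃₀ {K : Set X | K ⊆ U ∧ IsCompact K ∧ ∀ g ∈ G, (g : X ≃ₜ X) '' K = K}) :
    [ -- (i)
      IsOpen Ustar ∧ ∀ x ∈ Ustar, SRecurrent S x,
      -- (ii)
      IsOpen Ustar ∧ ∀ x ∈ Ustar, AlmostPeriodicPt G x,
      -- (iii)
      ∀ V : Set X, V ⊆ U → IsCompact V → IsOpen V →
        IsOpen (⋂ g ∈ G, (g : X ≃ₜ X) '' V),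
      -- (iv)
      ∀ x ∈ U, ∀ y ∈ Ustar, y ∈ closure (MulAction.orbit G x) →
        x ∈ closure (MulAction.orbit G y),
      -- (v)
      ∃ W : Set X, IsOpen W ∧ Ustar ⊆ W ∧
        IsClosed {p : ↥W × ↥W | (p.2 : X) ∈ closure (MulAction.orbit G (p.1 : X))},
      -- (vi)
      IsOpen Ustar ∧ ∃ (Y : Type u) (tY : TopologicalSpace Y),
        @T2Space Y tY ∧ @LocallyCompactSpace Y tY ∧ @ZeroDimensional Y tY ∧
        ∃ φ : ↥Ustar → Y, @Topology.IsQuotientMap ↥Ustar Y _ tY φ ∧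
          (∀ g ∈ G, ∀ (a : ↥Ustar) (ha : (g : X ≃ₜ X) (a : X) ∈ Ustar),
            φ ⟨(g : X ≃ₜ X) (a : X), ha⟩ = φ a) ∧
          ∀ a b : ↥Ustar, φ a = φ b →
            (b : X) ∈ closure (MulAction.orbit G (a : X)) ].TFAE := by
  have hA : LocallyUniform S := by
    obtain ⟨u, rfl, hS⟩ := hequi
    exact hS.locallyUniform
  rw [sUnion_invariant_eq hzd hU] at hUstar
  have hmem : ∀ {x}, x ∈ Ustar → ∃ V ⊆ U, IsCompact V ∧ IsOpen V ∧ x ∈ invCore G V := by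
    intro x hx
    rw [hUstar] at hx
    obtain ⟨_, ⟨V, ⟨hVU, hVc, hVo⟩, rfl⟩, hxV⟩ := hx
    exact ⟨V, hVU, hVc, hVo, hxV⟩
  have hsub : ∀ {V}, V ⊆ U → IsCompact V → IsOpen V → invCore G V ⊆ Ustar := by
    intro V hVU hVc hVo
    rw [hUstar]
    exact subset_sUnion_of_mem ⟨V, ⟨hVU, hVc, hVo⟩, rfl⟩
  have hUU : Ustar ⊆ U := fun x hx => by
    obtain ⟨V, hVU, -, -, hxV⟩ := hmem hx
    exact hVU (invCore_subset hxV)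
  have hcl : ∀ x ∈ Ustar, closure (MulAction.orbit G x) ⊆ Ustar := fun x hx y hy => by
    obtain ⟨V, hVU, hVc, hVo, hxV⟩ := hmem hx
    exact hsub hVU hVc hVo (mem_invCore_of_mem_closure_orbit hVc.isClosed hxV hy)
  have hcpt : ∀ x ∈ Ustar, IsCompact (closure (MulAction.orbit G x)) := fun x hx => by
    obtain ⟨V, hVU, hVc, hVo, hxV⟩ := hmem hx
    exact (isCompact_invCore hVc).of_isClosed_subset isClosed_closure fun y hy =>
      mem_invCore_of_mem_closure_orbit hVc.isClosed hxV hy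
  have hback : IsOpen Ustar → ∀ z, ∀ y ∈ Ustar, y ∈ closure (MulAction.orbit G z) →
      z ∈ Ustar := by
    intro ho z y hy hyz
    obtain ⟨g, hg, hgz⟩ := mem_closure_orbit_iff.1 hyz _ ho hy
    exact hcl _ hgz (mem_closure_orbit_apply hg z)
  have hbiInter := biInter_image_eq_invCore G
  simp only [hbiInter]
  have hescape : ∀ V ⊆ U, IsCompact V → IsOpen V → ¬ IsOpen (invCore G V) →
      ∃ z ∈ V, z ∉ wordCore S V 1 ∧ (∀ n, ∃ h ∈ S ^ n, h z ∈ wordCore S V n) ∧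
        ∃ y ∈ Ustar, y ∈ closure (MulAction.orbit G z) ∧ z ∉ closure (MulAction.orbit G y) := by
    intro V hVU hVc hVo hV
    obtain ⟨z, hzV, hz1, hz⟩ := exists_escaping_point hS1 hSinv hSgen hA hVc hVo hV
    obtain ⟨y, hy, hyz⟩ := exists_mem_invCore_mem_closure_orbit hS1 hSinv hSgen hA hVc hVo hz
    exact ⟨z, hzV, hz1, hz, y, hsub hVU hVc hVo hy, hyz, fun h =>
      notMem_invCore_of_notMem_wordCore hSinv hSgen hz1
        (mem_invCore_of_mem_closure_orbit hVc.isClosed hy h)⟩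
  have hopen : (∀ V ⊆ U, IsCompact V → IsOpen V → IsOpen (invCore G V)) → IsOpen Ustar := by
    intro h3
    rw [hUstar]
    refine isOpen_sUnion ?_
    rintro _ ⟨V, ⟨hVU, hVc, hVo⟩, rfl⟩
    exact h3 V hVU hVc hVo
  tfae_have 2 → 1 := fun ⟨ho, h⟩ =>
    ⟨ho, fun x hx => AlmostPeriodicPt.sRecurrent hS1 hSinv (hSgen ▸ h x hx)⟩
  tfae_have 1 → 3 := by
    rintro ⟨ho, hrec⟩ V hVU hVc hVo
    by_contra hV
    obtain ⟨z, hzV, hz1, hz, y, hy, hyz, -⟩ := hescape V hVU hVc hVo hV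
    exact hz1 ((hrec z (hback ho z y hy hyz)).mem_wordCore_one hS1 hSinv hA hVc hVo hzV hz)
  tfae_have 4 → 3 := by
    intro h4 V hVU hVc hVo
    by_contra hV
    obtain ⟨z, hzV, -, -, y, hy, hyz, hzy⟩ := hescape V hVU hVc hVo hV
    exact hzy (h4 z (hVU hzV) y hy hyz)
  tfae_have 3 → 4 := by
    intro h3 x hx y hy hyx
    by_contra hxy
    have hxs : x ∈ Ustar := hback (hopen h3) x y hy hyx
    obtain ⟨V, hVO, hVc, hVo, hyV⟩ := exists_isOpen_invCore_of_subset hzd h3 (hcpt y hy)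
      (hU.inter isOpen_compl_singleton) inter_subset_left
      (fun w hw => ⟨hUU (hcl y hy hw), fun h : w = x => hxy (h ▸ hw)⟩)
    exact (hVO (invCore_subset (mem_invCore_of_isOpen hVo hyV hyx))).2 rfl
  tfae_have 3 → 2 := by
    intro h3
    have h4 := tfae_3_to_4 h3
    exact ⟨hopen h3, fun x hx => almostPeriodicPt_of_symm (hcpt x hx) fun y hy =>
      h4 x (hUU hx) y (hcl x hx hy) hy⟩
  tfae_have 3 → 6 := by
    intro h3
    have h4 := tfae_3_to_4 h3
    refine ⟨hopen h3, exists_quotient_of_invCore (hopen h3)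
      (fun x hx y hy => h4 x (hUU hx) y hy) hcl fun x hx O hO hxO => ?_⟩
    exact exists_isOpen_invCore_of_subset hzd h3 (hcpt x hx) (hO.inter (hopen h3))
      (inter_subset_right.trans hUU) (subset_inter hxO (hcl x hx))
  tfae_have 6 → 5 := by
    rintro ⟨ho, Y, tY, hT2, -, -, φ, hφ, hφG, hφmin⟩
    refine ⟨Ustar, ho, subset_rfl, ?_⟩
    have heq : {p : ↥Ustar × ↥Ustar | (p.2 : X) ∈ closure (MulAction.orbit G (p.1 : X))} =
        {p | φ p.1 = φ p.2} := by
      ext ⟨a, b⟩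
      refine ⟨fun h => ?_, hφmin a b⟩
      have hfib : IsClosed (φ ⁻¹' {φ a}) := isClosed_singleton.preimage hφ.continuous
      obtain ⟨C, hC, hCa⟩ := isClosed_induced_iff.1 hfib
      have hb : (b : X) ∈ C := mem_of_mem_closure_orbit h hC fun g hg => by
        have hga := hcl a a.2 (apply_mem_closure_orbit hg _)
        have : (⟨g a, hga⟩ : Ustar) ∈ φ ⁻¹' {φ a} := hφG g hg a hga
        rwa [← hCa] at this
      have : b ∈ φ ⁻¹' {φ a} := by rwa [← hCa]
      exact Eq.symm this
    rw [heq]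
    exact isClosed_eq (hφ.continuous.comp continuous_fst) (hφ.continuous.comp continuous_snd)
  tfae_have 5 → 3 := by
    rintro ⟨W, hWo, hUW, hR⟩ V hVU hVc hVo
    obtain ⟨V', hVc', hVo', hVV', hVW'⟩ := hzd.exists_isCompact_isOpen_between
      (isCompact_invCore (G := G) hVc) (hVo.inter hWo)
      (subset_inter invCore_subset ((hsub hVU hVc hVo).trans hUW))
    have heq : invCore G V = invCore G V' :=
      subset_antisymm (fun x hx g hg => hVV' (apply_mem_invCore hg hx))
        fun x hx g hg => (hVW' (hx g hg)).1
    rw [heq]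
    by_contra hV
    obtain ⟨z, hzV, -, -, y, hy, hyz, hzy⟩ :=
      hescape V' (fun x hx => hVU (hVW' hx).1) hVc' hVo' hV
    have hsec : IsClosed {w : W | z ∈ closure (MulAction.orbit G (w : X))} :=
      hR.preimage (f := fun w : W => (w, (⟨z, (hVW' hzV).2⟩ : W))) (by fun_prop)
    have hyc : (⟨y, hUW hy⟩ : W) ∈ {w : W | z ∈ closure (MulAction.orbit G (w : X))} := by
      rw [← hsec.closure_eq, mem_closure_iff]
      intro O hO hyO
      obtain ⟨g, hg, w, hw, hwz⟩ := mem_closure_orbit_iff.1 hyz _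
        (hWo.isOpenMap_subtype_val O hO) ⟨_, hyO, rfl⟩
      refine ⟨w, hw, ?_⟩
      rw [mem_ofPred_eq, hwz]
      exact mem_closure_orbit_apply hg z
    exact hzy hyc
  tfae_finish

end Reid
end

section
/- Let X be a locally compact zero-dimensional space equipped with a compatible uniformity, let S ⊆ Homeo(X) with 1 ∈ S and S = S⁻¹, let G = ⟨S⟩. Suppose that the action of G on X is distal and that closure(Gx) is compact for every x ∈ X. Then G is equicontinuous if and only if S is equicontinuous. -/
open Filter Topology Set Pointwise Uniformity

namespace Reid

/-- `(x, y)` is a proximal pair for the action of `H` if `(z, z)` is in the closure of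
`{(h x, h y) | h ∈ H}` for some `z`. -/
def IsProximalPair (H : Type*) {X : Type*} [Group H] [TopologicalSpace X] [MulAction H X]
    (x y : X) : Prop :=
  ∃ z : X, (z, z) ∈ closure {p : X × X | ∃ h : H, p = (h • x, h • y)}

/-- `x` is a distal point for the action of `H` if the only `y` with `(x, y)` proximal is `x`. -/
def IsDistalPoint (H : Type*) {X : Type*} [Group H] [TopologicalSpace X] [MulAction H X]
    (x : X) : Prop :=
  ∀ y : X, IsProximalPair H x y → y = x

section Action

variable {Γ Y : Type*} [Group Γ] [MulAction Γ Y]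

/-- The set of points all of whose `S`-translates lie in `V`. -/
def erosion (S : Set Γ) (V : Set Y) : Set Y := {x | ∀ s ∈ S, s • x ∈ V}

/-- The set of points at least one of whose `S`-translates lies in `V`. -/
def dilation (S : Set Γ) (V : Set Y) : Set Y := {x | ∃ s ∈ S, s • x ∈ V}

theorem gc_dilation_erosion {S : Set Γ} (hS : ∀ s ∈ S, s⁻¹ ∈ S) :
    GaloisConnection (dilation S : Set Y → Set Y) (erosion S) := by
  intro V W
  constructor
  · intro h x hx s hs
    exact h ⟨s⁻¹, hS s hs, by simpa using hx⟩
  · rintro h x ⟨s, hs, hx⟩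
    simpa using h hx s⁻¹ (hS s hs)

theorem erosion_subset {S : Set Γ} (h1 : 1 ∈ S) (V : Set Y) : erosion S V ⊆ V :=
  fun x hx => by simpa using hx 1 h1

theorem antitone_iterate_erosion {S : Set Γ} (h1 : 1 ∈ S) (V : Set Y) :
    Antitone fun n => (erosion S)^[n] V :=
  antitone_nat_of_succ_le fun n => by
    rw [Function.iterate_succ_apply']
    exact erosion_subset h1 _

theorem gc_iterate_dilation_erosion {S : Set Γ} (hS : ∀ s ∈ S, s⁻¹ ∈ S) (n : ℕ) :
    GaloisConnection ((dilation S : Set Y → Set Y)^[n]) ((erosion S)^[n]) := by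
  induction n with
  | zero => exact GaloisConnection.id
  | succ n ih =>
    rw [Function.iterate_succ, Function.iterate_succ']
    exact (gc_dilation_erosion hS).compose ih

theorem exists_smul_mem_of_mem_iterate_dilation {S : Set Γ} (n : ℕ) {V : Set Y} {x : Y}
    (hx : x ∈ (dilation S)^[n] V) : ∃ g : Γ, g • x ∈ V := by
  induction n generalizing V with
  | zero => exact ⟨1, by simpa using hx⟩
  | succ n ih =>
    rw [Function.iterate_succ_apply] at hx
    obtain ⟨g, s, -, h⟩ := ih hx
    exact ⟨s * g, by rwa [mul_smul]⟩

theorem smul_mem_of_subset_erosion {S : Set Γ} (hS : ∀ s ∈ S, s⁻¹ ∈ S)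
    (hgen : Subgroup.closure S = ⊤) {V : Set Y} (hV : V ⊆ erosion S V) (g : Γ) {x : Y}
    (hx : x ∈ V) : g • x ∈ V := by
  have hg : g ∈ Subgroup.closure S := hgen ▸ Subgroup.mem_top g
  induction hg using Subgroup.closure_induction'' generalizing x with
  | mem s hs => exact hV hx s hs
  | inv_mem s hs => exact hV hx _ (hS s hs)
  | one => simpa using hx
  | mul a b _ _ ha hb => rw [mul_smul]; exact ha (hb hx)

section Uniform

variable [UniformSpace Y]

theorem exists_entourage_mem_iff {V : Set Y} (hc : IsCompact V) (ho : IsOpen V) :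
    ∃ E ∈ 𝓤 Y, ∀ a b, (a, b) ∈ E → (a ∈ V ↔ b ∈ V) := by
  obtain ⟨E, hE, -, h⟩ := lebesgue_number_of_compact_open hc ho subset_rfl
  refine ⟨E ∩ Prod.swap ⁻¹' E, inter_mem hE (tendsto_swap_uniformity hE), ?_⟩
  rintro a b ⟨hab, hba⟩
  exact ⟨fun ha => h a ha hab, fun hb => h b hb hba⟩

theorem eventually_smul_mem_iff {S : Set Γ}
    (hequi : ∀ x : Y, ∀ E ∈ 𝓤 Y, ∀ᶠ y in 𝓝 x, ∀ s ∈ S, (s • x, s • y) ∈ E)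
    {V : Set Y} (hc : IsCompact V) (ho : IsOpen V) (x : Y) :
    ∀ᶠ y in 𝓝 x, ∀ s ∈ S, (s • x ∈ V ↔ s • y ∈ V) := by
  obtain ⟨E, hE, h⟩ := exists_entourage_mem_iff hc ho
  filter_upwards [hequi x E hE] with y hy s hs using h _ _ (hy s hs)

theorem isOpen_erosion {S : Set Γ}
    (hequi : ∀ x : Y, ∀ E ∈ 𝓤 Y, ∀ᶠ y in 𝓝 x, ∀ s ∈ S, (s • x, s • y) ∈ E)
    {V : Set Y} (hc : IsCompact V) (ho : IsOpen V) : IsOpen (erosion S V) := by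
  rw [isOpen_iff_mem_nhds]
  intro x hx
  filter_upwards [eventually_smul_mem_iff hequi hc ho x] with y hy s hs
  exact (hy s hs).1 (hx s hs)

theorem isOpen_dilation {S : Set Γ}
    (hequi : ∀ x : Y, ∀ E ∈ 𝓤 Y, ∀ᶠ y in 𝓝 x, ∀ s ∈ S, (s • x, s • y) ∈ E)
    {V : Set Y} (hc : IsCompact V) (ho : IsOpen V) : IsOpen (dilation S V) := by
  rw [isOpen_iff_mem_nhds]
  rintro x ⟨s, hs, hx⟩
  filter_upwards [eventually_smul_mem_iff hequi hc ho x] with y hy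
  exact ⟨s, hs, (hy s hs).1 hx⟩

theorem isClosed_dilation {S : Set Γ}
    (hequi : ∀ x : Y, ∀ E ∈ 𝓤 Y, ∀ᶠ y in 𝓝 x, ∀ s ∈ S, (s • x, s • y) ∈ E)
    {V : Set Y} (hc : IsCompact V) (ho : IsOpen V) : IsClosed (dilation S V) := by
  rw [← isOpen_compl_iff, isOpen_iff_mem_nhds]
  intro x hx
  filter_upwards [eventually_smul_mem_iff hequi hc ho x] with y hy
  rintro ⟨s, hs, h⟩
  exact hx ⟨s, hs, (hy s hs).2 h⟩

theorem isCompact_isOpen_iterate_dilation {S : Set Γ}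
    (hequi : ∀ x : Y, ∀ E ∈ 𝓤 Y, ∀ᶠ y in 𝓝 x, ∀ s ∈ S, (s • x, s • y) ∈ E)
    {V K : Set Y} (hc : IsCompact V) (ho : IsOpen V) (hK : IsCompact K) {n : ℕ}
    (hsub : ∀ i ≤ n, (dilation S)^[i] V ⊆ K) :
    IsCompact ((dilation S)^[n] V) ∧ IsOpen ((dilation S)^[n] V) := by
  induction n with
  | zero => exact ⟨hc, ho⟩
  | succ n ih =>
    have ih := ih fun i hi => hsub i (hi.trans n.le_succ)
    have := hsub (n + 1) le_rfl
    rw [Function.iterate_succ_apply'] at this ⊢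
    exact ⟨hK.of_isClosed_subset (isClosed_dilation hequi ih.1 ih.2) this,
      isOpen_dilation hequi ih.1 ih.2⟩

variable [T2Space Y]

theorem isCompact_isOpen_iterate_erosion {S : Set Γ} (h1 : 1 ∈ S)
    (hact : ∀ g : Γ, Continuous fun x : Y => g • x)
    (hequi : ∀ x : Y, ∀ E ∈ 𝓤 Y, ∀ᶠ y in 𝓝 x, ∀ s ∈ S, (s • x, s • y) ∈ E)
    {V : Set Y} (hc : IsCompact V) (ho : IsOpen V) (n : ℕ) :
    IsCompact ((erosion S)^[n] V) ∧ IsOpen ((erosion S)^[n] V) := by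
  induction n with
  | zero => exact ⟨hc, ho⟩
  | succ n ih =>
    rw [Function.iterate_succ_apply']
    refine ⟨ih.1.of_isClosed_subset ?_ (erosion_subset h1 _), isOpen_erosion hequi ih.1 ih.2⟩
    have : erosion S ((erosion S)^[n] V) =
        ⋂ s ∈ S, (fun x => s • x) ⁻¹' ((erosion S)^[n] V) := by
      ext x; simp [erosion]
    rw [this]
    exact isClosed_biInter fun s _ => ih.1.isClosed.preimage (hact s)

/-- If an equicontinuous symmetric set `S` generates a group all of whose orbit closures are
compact and minimal, then the largest invariant subset of a compact open set is open. -/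
theorem exists_isOpen_invariant_subset {S : Set Γ} (h1 : 1 ∈ S) (hS : ∀ s ∈ S, s⁻¹ ∈ S)
    (hgen : Subgroup.closure S = ⊤) (hact : ∀ g : Γ, Continuous fun x : Y => g • x)
    (hequi : ∀ x : Y, ∀ E ∈ 𝓤 Y, ∀ᶠ y in 𝓝 x, ∀ s ∈ S, (s • x, s • y) ∈ E)
    (hcpt : ∀ x : Y, IsCompact (closure (MulAction.orbit Γ x)))
    (hmin : ∀ y z : Y, z ∈ closure (MulAction.orbit Γ y) → y ∈ closure (MulAction.orbit Γ z))
    {U : Set Y} (hc : IsCompact U) (ho : IsOpen U) :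
    ∃ W ⊆ U, IsOpen W ∧ (∀ (g : Γ), ∀ x ∈ W, g • x ∈ W) ∧
      ∀ x, (∀ g : Γ, g • x ∈ U) → x ∈ W := by
  have hA := isCompact_isOpen_iterate_erosion h1 hact hequi hc ho
  have hgc := gc_iterate_dilation_erosion (Y := Y) hS
  have hanti := antitone_iterate_erosion h1 U
  let Q : ℕ → Set Y := fun n => (dilation S)^[n] ((erosion S)^[n] U)
  have hQc (n : ℕ) : IsCompact (Q n) := by
    refine (isCompact_isOpen_iterate_dilation hequi (hA n).1 (hA n).2 hc fun i hi => ?_).1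
    exact ((hgc i).monotone_l (hanti hi)).trans ((hgc i).l_u_le U)
  have hQanti : ∀ n, Q (n + 1) ⊆ Q n := by
    intro n
    change (dilation S)^[n + 1] ((erosion S)^[n + 1] U) ⊆ _
    rw [Function.iterate_succ_apply, Function.iterate_succ_apply']
    exact (hgc n).monotone_l ((gc_dilation_erosion hS).l_u_le _)
  have hinter : ⋂ n, Q n ⊆ erosion S U := by
    intro y hy
    have hne (n : ℕ) : (closure (MulAction.orbit Γ y) ∩ (erosion S)^[n] U).Nonempty := by
      obtain ⟨g, hg⟩ := exists_smul_mem_of_mem_iterate_dilation n (mem_iInter.1 hy n)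
      exact ⟨g • y, subset_closure ⟨g, rfl⟩, hg⟩
    obtain ⟨z, hz⟩ := IsCompact.nonempty_iInter_of_sequence_nonempty_isCompact_isClosed
      (fun n => closure (MulAction.orbit Γ y) ∩ (erosion S)^[n] U)
      (fun n => inter_subset_inter_right _ (hanti n.le_succ)) hne
      ((hcpt y).inter_right (hA 0).1.isClosed)
      (fun n => isClosed_closure.inter (hA n).1.isClosed)
    rw [mem_iInter] at hz
    have hinv : ⋂ n, (erosion S)^[n] U ⊆ erosion S (⋂ n, (erosion S)^[n] U) := by
      intro x hx s hs
      rw [mem_iInter] at hx ⊢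
      intro n
      have := hx (n + 1)
      rw [Function.iterate_succ_apply'] at this
      exact this s hs
    have horb : closure (MulAction.orbit Γ z) ⊆ ⋂ n, (erosion S)^[n] U := by
      refine closure_minimal ?_ (isClosed_iInter fun n => (hA n).1.isClosed)
      rintro _ ⟨g, rfl⟩
      exact smul_mem_of_subset_erosion hS hgen hinv g (mem_iInter.2 fun n => (hz n).2)
    exact mem_iInter.1 (horb (hmin y z (hz 0).1)) 1
  obtain ⟨n, hn⟩ : ∃ n, Q n ⊆ erosion S U :=
    exists_subset_nhds_of_isCompact (antitone_nat_of_succ_le hQanti).directed_ge hQc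
      fun x hx => (hA 1).2.mem_nhds (hinter hx)
  refine ⟨(erosion S)^[n] U, hanti n.zero_le, (hA n).2, fun g x hx => ?_, fun x hx => ?_⟩
  · refine smul_mem_of_subset_erosion hS hgen ?_ g hx
    rw [← Function.iterate_succ_apply' (erosion S), Function.iterate_succ_apply]
    exact (hgc n).le_u hn
  · have hinv : MulAction.orbit Γ x ⊆ (erosion S)^[n] U := by
      clear hn
      induction n with
      | zero => rintro _ ⟨g, rfl⟩; exact hx g
      | succ n ih =>
        rw [Function.iterate_succ_apply']
        rintro _ ⟨g, rfl⟩ s -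
        exact ih ⟨s * g, mul_smul s g x⟩
    exact hinv ⟨1, one_smul Γ x⟩

end Uniform

/-- A distal action with compact orbit closures is minimal on each orbit closure. -/
theorem mem_closure_orbit_of_distal [TopologicalSpace Y] [T2Space Y]
    (hact : ∀ g : Γ, Continuous fun x : Y => g • x)
    (hdistal : ∀ x : Y, IsDistalPoint Γ x)
    (hcpt : ∀ x : Y, IsCompact (closure (MulAction.orbit Γ x))) (y z : Y)
    (hz : z ∈ closure (MulAction.orbit Γ y)) : y ∈ closure (MulAction.orbit Γ z) := by
  let : TopologicalSpace (Function.End Y) := Pi.topologicalSpace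
  have : T2Space (Function.End Y) := inferInstanceAs (T2Space (Y → Y))
  have heval (x : Y) : Continuous fun p : Function.End Y => p x := continuous_apply x
  let T : Set (Function.End Y) := range fun (g : Γ) (x : Y) => g • x
  have hright (q : Function.End Y) : Continuous fun p : Function.End Y => p * q :=
    continuous_pi fun x => heval (q x)
  have horb {p : Function.End Y} (hp : p ∈ closure T) (x : Y) :
      p x ∈ closure (MulAction.orbit Γ x) :=
    map_mem_closure (f := fun p : Function.End Y => p x) (heval x) hp (by rintro _ ⟨g, rfl⟩; exact ⟨g, rfl⟩)
  have hT : IsCompact (closure T) :=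
    (isCompact_univ_pi hcpt).of_isClosed_subset isClosed_closure fun p hp x _ => horb hp x
  have hmul {p q : Function.End Y} (hp : p ∈ closure T) (hq : q ∈ closure T) :
      p * q ∈ closure T := by
    rw [← closure_closure]
    refine map_mem_closure (f := fun p : Function.End Y => p * q) (hright q) hp ?_
    rintro _ ⟨g, rfl⟩
    have hg : Continuous fun p : Function.End Y => ((fun x => g • p x : Y → Y) : Function.End Y) :=
      continuous_pi fun x => (hact g).comp (heval x)
    refine map_mem_closure hg hq ?_
    rintro _ ⟨h, rfl⟩
    exact ⟨g * h, funext fun x => mul_smul g h x⟩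
  have htrans {a b : Y} (h : a ∈ closure (MulAction.orbit Γ b)) :
      closure (MulAction.orbit Γ a) ⊆ closure (MulAction.orbit Γ b) := by
    refine closure_minimal ?_ isClosed_closure
    rintro _ ⟨g, rfl⟩
    refine map_mem_closure (hact g) h ?_
    rintro _ ⟨k, rfl⟩
    exact ⟨g * k, mul_smul g k b⟩
  have hzT : ∃ p ∈ closure T, p y = z := by
    have himg : (fun p : Function.End Y => p y) '' closure T = closure (MulAction.orbit Γ y) := by
      refine Subset.antisymm (image_subset_iff.2 fun p hp => horb hp y)
        (closure_minimal ?_ (hT.image (heval y)).isClosed)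
      rintro _ ⟨g, rfl⟩
      exact ⟨_, subset_closure ⟨g, rfl⟩, rfl⟩
    exact himg.symm.subset hz
  obtain ⟨p, hp, rfl⟩ := hzT
  obtain ⟨u, ⟨hu, huy⟩, hidem⟩ := exists_idempotent_in_compact_subsemigroup hright
    (closure T ∩ {q | q y ∈ closure (MulAction.orbit Γ (p y))})
    ⟨p, hp, subset_closure ⟨1, one_smul Γ _⟩⟩
    (hT.inter_right (isClosed_closure.preimage (heval y)))
    (fun a ha b hb => ⟨hmul ha.1 hb.1, htrans hb.2 (horb ha.1 (b y))⟩)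
  have hprox : IsProximalPair Γ y (u y) := by
    refine ⟨u y, ?_⟩
    have := map_mem_closure ((heval y).prodMk (heval (u y))) hu
      (t := {p : Y × Y | ∃ h : Γ, p = (h • y, h • u y)})
      (by rintro _ ⟨g, rfl⟩; exact ⟨g, rfl⟩)
    have huu : u (u y) = u y := congrFun hidem y
    rwa [huu] at this
  have huy' : u y ∈ closure (MulAction.orbit Γ (p y)) := huy
  rwa [hdistal y (u y) hprox] at huy'

theorem IsProximalPair.map {Z : Type*} [TopologicalSpace Y] [TopologicalSpace Z] [MulAction Γ Z]
    {f : Y → Z} (hf : Continuous f) (hsmul : ∀ (g : Γ) x, f (g • x) = g • f x) {x y : Y}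
    (h : IsProximalPair Γ x y) : IsProximalPair Γ (f x) (f y) := by
  obtain ⟨z, hz⟩ := h
  refine ⟨f z, map_mem_closure (f := Prod.map f f) (hf.prodMap hf) hz ?_⟩
  rintro _ ⟨g, rfl⟩
  exact ⟨g, by simp [hsmul]⟩

theorem isDistalPoint_prod [TopologicalSpace Y] (hdistal : ∀ x : Y, IsDistalPoint Γ x)
    (x : Y × Y) : IsDistalPoint Γ x := fun _ h =>
  Prod.ext (hdistal _ _ (h.map continuous_fst fun _ _ => rfl))
    (hdistal _ _ (h.map continuous_snd fun _ _ => rfl))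

theorem isCompact_closure_orbit_prod [TopologicalSpace Y]
    (hcpt : ∀ x : Y, IsCompact (closure (MulAction.orbit Γ x))) (x : Y × Y) :
    IsCompact (closure (MulAction.orbit Γ x)) := by
  refine ((hcpt x.1).prod (hcpt x.2)).of_isClosed_subset isClosed_closure
    (closure_minimal ?_ (isClosed_closure.prod isClosed_closure))
  rintro _ ⟨g, rfl⟩
  exact ⟨subset_closure ⟨g, rfl⟩, subset_closure ⟨g, rfl⟩⟩

theorem eventually_smul_mem_uniformity_prod [UniformSpace Y] {S : Set Γ}
    (hequi : ∀ x : Y, ∀ E ∈ 𝓤 Y, ∀ᶠ y in 𝓝 x, ∀ s ∈ S, (s • x, s • y) ∈ E)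
    (x : Y × Y) (E : Set ((Y × Y) × Y × Y)) (hE : E ∈ 𝓤 (Y × Y)) :
    ∀ᶠ y in 𝓝 x, ∀ s ∈ S, (s • x, s • y) ∈ E := by
  obtain ⟨A, hA, B, hB, hAB⟩ := entourageProd_subset hE
  rw [nhds_prod_eq]
  filter_upwards [prod_mem_prod (hequi x.1 A hA) (hequi x.2 B hB)] with y hy s hs
  exact hAB ⟨hy.1 s hs, hy.2 s hs⟩

end Action

theorem exists_isCompact_isOpen_mem_subset {X : Type*} [TopologicalSpace X]
    [LocallyCompactSpace X] (hzd : ZeroDimensional X) {x : X} {O : Set X} (hO : O ∈ 𝓝 x) :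
    ∃ V, IsCompact V ∧ IsOpen V ∧ x ∈ V ∧ V ⊆ O := by
  obtain ⟨B, hB, hcl⟩ := hzd
  obtain ⟨K, hK, hKO, hKc⟩ := local_compact_nhds hO
  obtain ⟨V, hV, hxV, hVK⟩ := hB.mem_nhds_iff.1 hK
  exact ⟨V, hKc.of_isClosed_subset (hcl V hV).isClosed hVK, (hcl V hV).isOpen, hxV,
    hVK.trans hKO⟩

theorem exists_isCompact_isOpen_diagonal_subset {X : Type*} [UniformSpace X]
    [LocallyCompactSpace X] (hzd : ZeroDimensional X) {K : Set X} (hK : IsCompact K)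
    {E : Set (X × X)} (hE : E ∈ 𝓤 X) :
    ∃ U : Set (X × X), IsCompact U ∧ IsOpen U ∧ (∀ x ∈ K, (x, x) ∈ U) ∧ U ⊆ E := by
  refine hK.induction_on ⟨∅, isCompact_empty, isOpen_empty, by simp, by simp⟩ ?_ ?_ ?_
  · rintro s t hst ⟨U, hc, ho, hU, hUE⟩
    exact ⟨U, hc, ho, fun x hx => hU x (hst hx), hUE⟩
  · rintro s t ⟨U, hc, ho, hU, hUE⟩ ⟨U', hc', ho', hU', hUE'⟩
    refine ⟨U ∪ U', hc.union hc', ho.union ho', ?_, union_subset hUE hUE'⟩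
    rintro x (hx | hx)
    exacts [Or.inl (hU x hx), Or.inr (hU' x hx)]
  · intro x _
    have hxE : E ∈ 𝓝 (x, x) := nhds_le_uniformity x hE
    rw [nhds_prod_eq, mem_prod_same_iff] at hxE
    obtain ⟨O, hO, hOE⟩ := hxE
    obtain ⟨V, hc, ho, hxV, hVO⟩ := exists_isCompact_isOpen_mem_subset hzd hO
    exact ⟨V, mem_nhdsWithin_of_mem_nhds (ho.mem_nhds hxV), V ×ˢ V, hc.prod hc, ho.prod ho,
      fun y hy => ⟨hy, hy⟩, (prod_mono hVO hVO).trans hOE⟩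

/-- Corollary 1.3: if `X` is locally compact zero-dimensional with a compatible uniformity,
`1 ∈ S = S⁻¹`, `G = ⟨S⟩` acts distally and all orbit closures are compact, then `G` is
equicontinuous if and only if `S` is equicontinuous. -/
theorem distal_group_equicontinuous_iff {X : Type*} [UniformSpace X] [T2Space X]
    [LocallyCompactSpace X] (hzd : ZeroDimensional X)
    (S : Set (X ≃ₜ X)) (hS1 : 1 ∈ S) (hSinv : S⁻¹ = S)
    (G : Subgroup (X ≃ₜ X)) (hSgen : Subgroup.closure S = G)
    (hdistal : ∀ x : X, IsDistalPoint (↥G) x)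
    (hcpt : ∀ x : X, IsCompact (closure (MulAction.orbit G x))) :
    EquicontinuousSet ‹UniformSpace X› (G : Set (X ≃ₜ X)) ↔
      EquicontinuousSet ‹UniformSpace X› S := by
  constructor
  · intro h x E hE
    obtain ⟨U, hU, hUE⟩ := h x E hE
    exact ⟨U, hU, fun s hs => hUE s (hSgen ▸ Subgroup.subset_closure hs)⟩
  · intro h x E hE
    subst hSgen
    let S' : Set (Subgroup.closure S) := (↑) ⁻¹' S
    have hS' : ∀ s ∈ S', s⁻¹ ∈ S' := by
      intro s hs
      change ((s : X ≃ₜ X))⁻¹ ∈ S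
      exact hSinv.subset (Set.inv_mem_inv.2 hs)
    have hact (g : Subgroup.closure S) : Continuous fun y : X => g • y :=
      (g : X ≃ₜ X).continuous
    have hactp (g : Subgroup.closure S) : Continuous fun y : X × X => g • y :=
      (hact g).prodMap (hact g)
    have hequi : ∀ x : X, ∀ E ∈ 𝓤 X, ∀ᶠ y in 𝓝 x, ∀ s ∈ S', (s • x, s • y) ∈ E := by
      intro x E hE
      obtain ⟨U, hU, hUE⟩ := h x E hE
      filter_upwards [hU] with y hy s hs using hUE s hs y hy
    obtain ⟨U, hc, ho, hKU, hUE⟩ := exists_isCompact_isOpen_diagonal_subset hzd (hcpt x) hE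
    obtain ⟨W, hWU, hWo, hinv, hmax⟩ := exists_isOpen_invariant_subset (S := S') hS1 hS'
      (Subgroup.closure_closure_coe_preimage (k := S)) hactp
      (eventually_smul_mem_uniformity_prod hequi) (isCompact_closure_orbit_prod hcpt)
      (mem_closure_orbit_of_distal hactp (isDistalPoint_prod hdistal)
        (isCompact_closure_orbit_prod hcpt)) hc ho
    have hxW : (x, x) ∈ W := hmax _ fun g => hKU _ (subset_closure ⟨g, rfl⟩)
    refine ⟨Prod.mk x ⁻¹' W,
      (Continuous.prodMk_right x).continuousAt.preimage_mem_nhds (hWo.mem_nhds hxW), ?_⟩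
    intro g hg y hy
    exact hUE (hWU (hinv ⟨g, hg⟩ _ hy))

end Reid
end

section
/- Let X be a locally compact Hausdorff space equipped with a uniformity, let S, T ⊆ Homeo(X) and let x ∈ X. Suppose that closure(Tx) is compact, T is equicontinuous at x, and every point of closure(Tx) is a point of equicontinuity for S. Then the set ST = {s∘t : s ∈ S, t ∈ T} is equicontinuous at x. If in addition closure(Sy) is compact for every y ∈ closure(Tx), then closure(STx) is compact. -/
open Filter Topology Set Pointwise Uniformity

namespace Reid

/-- Evaluation is jointly continuous on an equicontinuous set of functions with the topology of
pointwise convergence. -/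
theorem _root_.Set.Equicontinuous.continuousOn_eval {X Y : Type*} [UniformSpace X]
    [TopologicalSpace Y] {H : Set (Y → X)} (hH : H.Equicontinuous) :
    ContinuousOn (fun p : (Y → X) × Y => p.1 p.2) (H ×ˢ univ) := by
  rintro ⟨f, y⟩ -
  refine Uniform.tendsto_nhds_right.2 fun E hE => ?_
  obtain ⟨D, hD, hDE⟩ := comp_mem_uniformity_sets hE
  have hf : ∀ᶠ g : Y → X in 𝓝 f, (f y, g y) ∈ D :=
    Uniform.tendsto_nhds_right.1 (continuous_apply (A := fun _ : Y => X) y).continuousAt hD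
  have hfy := hf.prod_nhds (hH y D hD)
  rw [mem_map]
  filter_upwards [mem_nhdsWithin_of_mem_nhds hfy, self_mem_nhdsWithin] with p hp hpH
  exact hDE (SetRel.prodMk_mem_comp hp.1 (hp.2 ⟨p.1, hpH.1⟩))

/-- The values of an equicontinuous, pointwise relatively compact set of functions on a compact
space lie in a common compact set. -/
theorem exists_isCompact_forall_apply_mem {X Y : Type*} [UniformSpace X]
    [TopologicalSpace Y] [CompactSpace Y] {H : Set (Y → X)} (hH : H.Equicontinuous)
    (hcpt : ∀ y, IsCompact (closure ((fun f : Y → X => f y) '' H))) :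
    ∃ C, IsCompact C ∧ ∀ f ∈ H, ∀ y, f y ∈ C := by
  have hsub : closure H ⊆ univ.pi fun y => closure ((fun f : Y → X => f y) '' H) :=
    closure_minimal (fun f hf y _ => subset_closure (mem_image_of_mem _ hf))
      (isClosed_set_pi fun _ _ => isClosed_closure)
  have hcl : IsCompact (closure H) :=
    (isCompact_univ_pi hcpt).of_isClosed_subset isClosed_closure hsub
  exact ⟨_, (hcl.prod isCompact_univ).image_of_continuousOn hH.closure.continuousOn_eval,
    fun f hf y => ⟨(f, y), ⟨subset_closure hf, mem_univ y⟩, rfl⟩⟩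

/-- A set of homeomorphisms that is equicontinuous at every point of a compact set `K` is
equicontinuous uniformly over `K`. -/
theorem EquicontinuousAtPt.exists_entourage_of_isCompact {X : Type*} [UniformSpace X]
    {S : Set (X ≃ₜ X)} {K : Set X} (hK : IsCompact K)
    (hS : ∀ y ∈ K, EquicontinuousAtPt ‹UniformSpace X› S y) {E : Set (X × X)} (hE : E ∈ 𝓤 X) :
    ∃ D ∈ 𝓤 X, ∀ y ∈ K, ∀ z, (y, z) ∈ D → ∀ s ∈ S, (s y, s z) ∈ E := by
  obtain ⟨F, hF, hFsymm, hFE⟩ := comp_symm_mem_uniformity_sets hE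
  choose U hU hUF using fun y hy => hS y hy F hF
  obtain ⟨D, hD, hDU⟩ := lebesgue_number_lemma_nhds' hK hU
  refine ⟨D, hD, fun y hy z hyz s hs => ?_⟩
  obtain ⟨w, hw⟩ := hDU y hy
  have hwy := hUF w w.2 s hs y (hw (UniformSpace.mem_ball_self y hD))
  exact hFE (SetRel.prodMk_mem_comp (SetRel.symm F hwy) (hUF w w.2 s hs z (hw hyz)))

/-- Lemma 2.3(ii): if `closure (T x)` is compact, `T` is equicontinuous at `x`, and every point
of `closure (T x)` is a point of equicontinuity for `S`, then `S T` is equicontinuous at `x`;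
if moreover `closure (S y)` is compact for every `y ∈ closure (T x)`, then `closure (S T x)`
is compact. -/
theorem mul_equicontinuousAt {X : Type*} [UniformSpace X] [T2Space X] [LocallyCompactSpace X]
    (S T : Set (X ≃ₜ X)) (x : X)
    (hTx : IsCompact (closure ((fun t : X ≃ₜ X => t x) '' T)))
    (hT : EquicontinuousAtPt ‹UniformSpace X› T x)
    (hS : ∀ y ∈ closure ((fun t : X ≃ₜ X => t x) '' T),
      EquicontinuousAtPt ‹UniformSpace X› S y) :
    EquicontinuousAtPt ‹UniformSpace X› (S * T) x ∧
      ((∀ y ∈ closure ((fun t : X ≃ₜ X => t x) '' T),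
          IsCompact (closure ((fun s : X ≃ₜ X => s y) '' S))) →
        IsCompact (closure ((fun u : X ≃ₜ X => u x) '' (S * T)))) := by
  have hTmem : ∀ t ∈ T, t x ∈ closure ((fun t : X ≃ₜ X => t x) '' T) :=
    fun t ht => subset_closure (mem_image_of_mem _ ht)
  refine ⟨fun E hE => ?_, fun hSy => ?_⟩
  · obtain ⟨D, hD, hDE⟩ := EquicontinuousAtPt.exists_entourage_of_isCompact hTx hS hE
    obtain ⟨U, hU, hUD⟩ := hT D hD
    refine ⟨U, hU, ?_⟩
    rintro _ ⟨s, hs, t, ht, rfl⟩ y hy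
    exact hDE (t x) (hTmem t ht) (t y) (hUD t ht y hy) s hs
  · set K := closure ((fun t : X ≃ₜ X => t x) '' T)
    have : CompactSpace K := isCompact_iff_compactSpace.1 hTx
    let restr : (X ≃ₜ X) → K → X := fun s y => s y
    have hequi : (restr '' S).Equicontinuous := by
      intro y E hE
      obtain ⟨U, hU, hUE⟩ := hS y y.2 E hE
      filter_upwards [continuous_subtype_val.continuousAt hU] with z hz
      rintro ⟨_, s, hs, rfl⟩
      exact hUE s hs z hz
    obtain ⟨C, hC, hSC⟩ := exists_isCompact_forall_apply_mem hequi fun y => by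
      rw [image_image]
      exact hSy y y.2
    refine hC.closure_of_subset ?_
    rintro _ ⟨_, ⟨s, hs, t, ht, rfl⟩, rfl⟩
    exact hSC _ (mem_image_of_mem restr hs) ⟨t x, hTmem t ht⟩

end Reid
end

section
/- Let X be a locally compact Hausdorff topological space, let S be a set of homeomorphisms of X that is equicontinuous with respect to some compatible uniformity, and let U be a compact open subset of X. If both closure(S⁻¹U) and closure(SS⁻¹U) are compact, then the family of sets {s⁻¹(U) : s ∈ S} is finite. -/
open Filter Topology Set Pointwise Uniformity

namespace Reid

/-- Lemma 2.4(ii): if `S` is an equicontinuous set of homeomorphisms with respect to some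
compatible uniformity, `U` is compact open, and both `closure (S⁻¹ U)` and `closure (S S⁻¹ U)`
are compact, then `{s⁻¹(U) | s ∈ S}` is finite. -/
theorem finite_preimages {X : Type*} [TopologicalSpace X] [T2Space X] [LocallyCompactSpace X]
    (S : Set (X ≃ₜ X))
    (hequi : ∃ u : UniformSpace X, u.toTopologicalSpace = ‹TopologicalSpace X› ∧
      EquicontinuousSet u S)
    (U : Set X) (hUc : IsCompact U) (hUo : IsOpen U)
    (h1 : IsCompact (closure (⋃ s ∈ S, (s : X ≃ₜ X) ⁻¹' U)))
    (h2 : IsCompact (closure (⋃ s ∈ S, ⋃ t ∈ S, (s : X ≃ₜ X) '' ((t : X ≃ₜ X) ⁻¹' U)))) :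
    Set.Finite ((fun s : X ≃ₜ X => (s : X ≃ₜ X) ⁻¹' U) '' S) := by
  obtain ⟨u, rfl, hu⟩ := hequi
  obtain ⟨E, hE, -, hEU⟩ := lebesgue_number_of_compact_open hUc hUo subset_rfl
  have hnhds : ∀ x : X, ∃ V ∈ 𝓝 x, ∀ s ∈ S, ∀ y ∈ V, (s x ∈ U ↔ s y ∈ U) := by
    intro x
    obtain ⟨V, hV, hVE⟩ := hu x _ (symmetrize_mem_uniformity hE)
    exact ⟨V, hV, fun s hs y hy =>
      ⟨fun hx => hEU _ hx (hVE s hs y hy).1, fun hy' => hEU _ hy' (hVE s hs y hy).2⟩⟩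
  choose V hV hVU using hnhds
  obtain ⟨F, -, hF⟩ := h1.elim_nhds_subcover V fun x _ => hV x
  refine ((F.finite_toSet.powerset).image fun T => ⋃ x ∈ T, V x).subset ?_
  rintro _ ⟨s, hs, rfl⟩
  refine ⟨{x ∈ (F : Set X) | s x ∈ U}, fun x hx => hx.1, ?_⟩
  ext y
  simp only [mem_iUnion, mem_preimage, mem_ofPred_eq, exists_prop]
  constructor
  · rintro ⟨x, ⟨-, hx⟩, hy⟩
    exact (hVU x s hs y hy).1 hx
  · intro hy
    obtain ⟨x, hxF, hyx⟩ := mem_iUnion₂.1 (hF (subset_closure (mem_biUnion hs hy)))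
    exact ⟨x, ⟨hxF, (hVU x s hs y hyx).2 hy⟩, hyx⟩

end Reid
end

section
/- Let X be a locally compact zero-dimensional space, let S ⊆ Homeo(X) with 1 ∈ S and S = S⁻¹, such that S is equicontinuous with respect to some compatible uniformity, and let G = ⟨S⟩. Let V be a compact open subset of X, let V₀ = ⋂_{s ∈ S} s⁻¹(V), and for n ∈ ℕ let V_n = ⋂_{g ∈ Sⁿ} g(V₀). Then for all n ∈ ℕ, V_n is compact and open, and for all 0 ≤ m ≤ n, the family of sets {g(V_n) : g ∈ S^m} is finite. -/
open Filter Topology Set Pointwise Uniformity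

namespace Reid

/-- The image of a set under a product of homeomorphisms is the iterated image. -/
theorem image_mul {X : Type*} [TopologicalSpace X] (f g : X ≃ₜ X) (A : Set X) :
    (f * g : X ≃ₜ X) '' A = f '' (g '' A) :=
  Set.image_comp f g A

theorem image_eq_preimage_inv {X : Type*} [TopologicalSpace X] (f : X ≃ₜ X) (A : Set X) :
    f '' A = (f⁻¹ : X ≃ₜ X) ⁻¹' A :=
  f.image_eq_preimage_symm A

/-- Membership in the preimages of a compact open set under an equicontinuous set of
homeomorphisms is locally constant, uniformly over the set. -/
theorem EquicontinuousSet.exists_nhds_mem_iff {X : Type*} [u : UniformSpace X]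
    {S : Set (X ≃ₜ X)} (hS : EquicontinuousSet u S) {W : Set X} (hWc : IsCompact W)
    (hWo : IsOpen W) (x : X) : ∃ U ∈ 𝓝 x, ∀ s ∈ S, ∀ y ∈ U, (s x ∈ W ↔ s y ∈ W) := by
  obtain ⟨E, hE, -, hEW⟩ := lebesgue_number_of_compact_open hWc hWo subset_rfl
  obtain ⟨U, hU, hUE⟩ := hS x _ (symmetrize_mem_uniformity hE)
  refine ⟨U, hU, fun s hs y hy => ⟨fun hx => hEW _ hx ?_, fun hx => hEW _ hx ?_⟩⟩
  · exact (hUE s hs y hy).1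
  · exact (hUE s hs y hy).2

/-- The preimages of a compact open set under an equicontinuous set of homeomorphisms have only
finitely many traces on a compact set. -/
theorem EquicontinuousSet.finite_preimage_inter {X : Type*} [u : UniformSpace X]
    {S : Set (X ≃ₜ X)} (hS : EquicontinuousSet u S) {W K : Set X} (hWc : IsCompact W)
    (hWo : IsOpen W) (hK : IsCompact K) :
    ((fun s : X ≃ₜ X => s ⁻¹' W ∩ K) '' S).Finite := by
  choose U hU hUW using hS.exists_nhds_mem_iff hWc hWo
  obtain ⟨t, -, ht⟩ := hK.elim_nhds_subcover U fun x _ => hU x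
  refine (t.finite_toSet.powerset.image fun A => (⋃ x ∈ A, U x) ∩ K).subset ?_
  rintro _ ⟨s, hs, rfl⟩
  refine ⟨{x | x ∈ t ∧ s x ∈ W}, fun x hx => hx.1, ?_⟩
  ext y
  simp only [mem_inter_iff, mem_iUnion, mem_ofPred_eq, mem_preimage, exists_prop]
  refine and_congr_left fun hy => ⟨?_, fun hyW => ?_⟩
  · rintro ⟨x, ⟨-, hx⟩, hyx⟩
    exact (hUW x s hs y hyx).1 hx
  · obtain ⟨x, hxt, hyx⟩ := mem_iUnion₂.1 (ht hy)
    exact ⟨x, ⟨hxt, (hUW x s hs y hyx).2 hyW⟩, hyx⟩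

theorem EquicontinuousSet.isOpen_iInter_preimage {X : Type*} [u : UniformSpace X]
    {S : Set (X ≃ₜ X)} (hS : EquicontinuousSet u S) {W : Set X} (hWc : IsCompact W)
    (hWo : IsOpen W) : IsOpen (⋂ s ∈ S, (s : X ≃ₜ X) ⁻¹' W) := by
  refine isOpen_iff_mem_nhds.2 fun x hx => ?_
  obtain ⟨U, hU, hUW⟩ := hS.exists_nhds_mem_iff hWc hWo x
  refine mem_of_superset hU fun y hy => mem_iInter₂.2 fun s hs => ?_
  exact (hUW s hs y hy).1 (mem_iInter₂.1 hx s hs)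

theorem isCompact_iInter_preimage {X : Type*} [TopologicalSpace X] [T2Space X]
    {S : Set (X ≃ₜ X)} (hS1 : 1 ∈ S) {W : Set X} (hWc : IsCompact W) :
    IsCompact (⋂ s ∈ S, (s : X ≃ₜ X) ⁻¹' W) :=
  hWc.of_isClosed_subset
    (isClosed_biInter fun s _ => hWc.isClosed.preimage s.continuous)
    (biInter_subset_of_mem hS1)

theorem iInter_image_eq_iInter_preimage {X : Type*} [TopologicalSpace X]
    {S : Set (X ≃ₜ X)} (hSinv : S⁻¹ = S) (W : Set X) :
    ⋂ s ∈ S, (s : X ≃ₜ X) '' W = ⋂ s ∈ S, (s : X ≃ₜ X) ⁻¹' W := by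
  simp only [image_eq_preimage_inv]
  conv_rhs => rw [← hSinv]
  ext x
  simp only [mem_iInter]
  exact ⟨fun h s hs => by simpa using h s⁻¹ hs, fun h s hs => h s⁻¹ (by simpa using hs)⟩

theorem iInter_image_pow_succ {X : Type*} [TopologicalSpace X] (S : Set (X ≃ₜ X)) (n : ℕ)
    (W : Set X) :
    ⋂ g ∈ S ^ (n + 1), (g : X ≃ₜ X) '' W =
      ⋂ s ∈ S, (s : X ≃ₜ X) '' ⋂ g ∈ S ^ n, (g : X ≃ₜ X) '' W := by
  rw [pow_succ']
  ext x
  simp only [mem_iInter, image_eq_preimage_inv, mem_preimage]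
  constructor
  · intro h s hs g hg
    simpa [mul_inv_rev] using h (s * g) (Set.mul_mem_mul hs hg)
  · rintro h _ ⟨s, hs, g, hg, rfl⟩
    simpa [mul_inv_rev] using h s hs g hg

/-- Corollary 2.5: with `S` equicontinuous (w.r.t. a compatible uniformity), `1 ∈ S = S⁻¹`,
`V` compact open, `V₀ = ⋂_{s ∈ S} s⁻¹(V)` and `V_n = ⋂_{g ∈ Sⁿ} g(V₀)`, each `V_n` is compact
open, and for `0 ≤ m ≤ n` the family `{g(V_n) | g ∈ S^m}` is finite. -/
theorem Vn_compact_open_finite_translates {X : Type*} [TopologicalSpace X] [T2Space X]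
    [LocallyCompactSpace X] (hzd : ZeroDimensional X)
    (S : Set (X ≃ₜ X)) (hS1 : 1 ∈ S) (hSinv : S⁻¹ = S)
    (G : Subgroup (X ≃ₜ X)) (hSgen : Subgroup.closure S = G)
    (hequi : ∃ u : UniformSpace X, u.toTopologicalSpace = ‹TopologicalSpace X› ∧
      EquicontinuousSet u S)
    (V : Set X) (hVc : IsCompact V) (hVo : IsOpen V)
    (V0 : Set X) (hV0 : V0 = ⋂ s ∈ S, (s : X ≃ₜ X) ⁻¹' V)
    (Vn : ℕ → Set X) (hVn : ∀ n : ℕ, Vn n = ⋂ g ∈ S ^ n, (g : X ≃ₜ X) '' V0) :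
    (∀ n : ℕ, IsCompact (Vn n) ∧ IsOpen (Vn n)) ∧
      ∀ m n : ℕ, m ≤ n → Set.Finite ((fun g : X ≃ₜ X => (g : X ≃ₜ X) '' Vn n) '' (S ^ m)) := by
  obtain ⟨u, rfl, hequi⟩ := hequi
  have hco : ∀ n, IsCompact (Vn n) ∧ IsOpen (Vn n) := by
    intro n
    induction n with
    | zero =>
      have h0 : Vn 0 = V0 := by
        rw [hVn, pow_zero]
        exact (biInter_singleton 1 _).trans (image_id V0)
      rw [h0, hV0]
      exact ⟨isCompact_iInter_preimage hS1 hVc, hequi.isOpen_iInter_preimage hVc hVo⟩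
    | succ n ih =>
      rw [hVn, iInter_image_pow_succ, ← hVn, iInter_image_eq_iInter_preimage hSinv]
      exact ⟨isCompact_iInter_preimage hS1 ih.1, hequi.isOpen_iInter_preimage ih.1 ih.2⟩
  have hV0V : V0 ⊆ V := hV0 ▸ biInter_subset_of_mem hS1
  have hsub : ∀ n, ∀ g ∈ S ^ n, (g : X ≃ₜ X) '' Vn n ⊆ V := by
    intro n g hg
    have hg' : g⁻¹ ∈ S ^ n := by
      rw [← hSinv, inv_pow]
      exact Set.inv_mem_inv.2 hg
    have h : Vn n ⊆ (g⁻¹ : X ≃ₜ X) '' V0 := by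
      rw [hVn]
      exact biInter_subset_of_mem hg'
    rw [image_eq_preimage_inv, inv_inv] at h
    exact (image_subset_iff.2 h).trans hV0V
  refine ⟨hco, fun m n => ?_⟩
  induction m with
  | zero =>
    intro _
    rw [pow_zero]
    exact (finite_singleton 1).image _
  | succ m ih =>
    intro hmn
    refine ((ih (by lia)).biUnion' (t := fun W _ =>
      (fun s : X ≃ₜ X => s ⁻¹' W ∩ V) '' S) ?_).subset ?_
    · rintro _ ⟨g, -, rfl⟩
      exact hequi.finite_preimage_inter ((hco n).1.image g.continuous)
        (g.isOpenMap _ (hco n).2) hVc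
    · rintro _ ⟨g, hg, rfl⟩
      have hgV := hsub n g (Set.pow_subset_pow_right hS1 hmn hg)
      rw [pow_succ'] at hg
      obtain ⟨s, hs, h, hh, rfl⟩ := hg
      refine mem_iUnion₂.2 ⟨h '' Vn n, mem_image_of_mem _ hh, s⁻¹, ?_, ?_⟩
      · rw [← hSinv]
        exact Set.inv_mem_inv.2 hs
      · change (s⁻¹ : X ≃ₜ X) ⁻¹' (h '' Vn n) ∩ V = (s * h : X ≃ₜ X) '' Vn n
        rw [← image_eq_preimage_inv, ← image_mul]
        exact inter_eq_left.2 hgV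

end Reid
end

section
/- Let H be a group acting by homeomorphisms on a Hausdorff topological space X. Let x, y ∈ X be such that closure(Hx) is compact and consists of distal points for the action. Then H acts minimally on closure(Hx); indeed, closure(Hy) = closure(Hx) whenever closure(Hx) ∩ closure(Hy) ≠ ∅. -/
open Filter Topology Set Pointwise Uniformity

namespace Reid

/-- The enveloping (Ellis) semigroup of an action: the closure, for pointwise convergence, of the
set of translations. -/
def envelopingSemigroup (H K : Type*) [Group H] [TopologicalSpace K] [MulAction H K] :
    Set (K → K) :=
  closure (range fun (h : H) (k : K) => h • k)

section EnvelopingSemigroup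

variable {H K : Type*} [Group H] [TopologicalSpace K] [MulAction H K]

theorem comp_mem_envelopingSemigroup [ContinuousConstSMul H K] {f g : K → K}
    (hf : f ∈ envelopingSemigroup H K) (hg : g ∈ envelopingSemigroup H K) :
    f ∘ g ∈ envelopingSemigroup H K := by
  have smul_comp_mem (h : H) : (fun k => h • g k) ∈ envelopingSemigroup H K := by
    refine map_mem_closure (f := fun (g : K → K) k => h • g k) (by fun_prop) hg ?_
    rintro _ ⟨h', rfl⟩
    exact ⟨h * h', funext fun k => mul_smul h h' k⟩
  have hcomp : Continuous fun f : K → K => f ∘ g :=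
    continuous_pi fun k => continuous_apply (g k)
  refine closure_minimal ?_ (isClosed_closure.preimage hcomp) hf
  rintro _ ⟨h, rfl⟩
  exact smul_comp_mem h

theorem isProximalPair_of_mem_envelopingSemigroup {f : K → K}
    (hf : f ∈ envelopingSemigroup H K) {a b : K} (hab : f a = f b) :
    IsProximalPair H a b := by
  have hmem : (f a, f b) ∈ closure {p : K × K | ∃ h : H, p = (h • a, h • b)} := by
    refine map_mem_closure (f := fun g : K → K => (g a, g b)) (by fun_prop) hf ?_
    rintro _ ⟨h, rfl⟩
    exact ⟨h, rfl⟩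
  exact ⟨f b, hab ▸ hmem⟩

theorem apply_mem_closure_orbit_s11 {f : K → K} (hf : f ∈ envelopingSemigroup H K) (k : K) :
    f k ∈ closure (MulAction.orbit H k) := by
  refine map_mem_closure (f := fun g : K → K => g k) (by fun_prop) hf ?_
  rintro _ ⟨h, rfl⟩
  exact ⟨h, rfl⟩

/-- The only idempotent in the enveloping semigroup of a distal action is the identity. -/
theorem eq_id_of_comp_self_eq (hdistal : ∀ k : K, IsDistalPoint H k) {f : K → K}
    (hf : f ∈ envelopingSemigroup H K) (hidem : f ∘ f = f) : f = id :=
  funext fun k => hdistal k (f k) <|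
    isProximalPair_of_mem_envelopingSemigroup hf (congrFun hidem k).symm

variable [CompactSpace K] [T2Space K] [ContinuousConstSMul H K]

theorem exists_comp_eq_id (hdistal : ∀ k : K, IsDistalPoint H k) {f : K → K}
    (hf : f ∈ envelopingSemigroup H K) : ∃ g ∈ envelopingSemigroup H K, g ∘ f = id := by
  let : Semigroup (K → K) :=
    { mul := fun f g => f ∘ g
      mul_assoc := fun _ _ _ => rfl }
  have hcomp (f : K → K) : Continuous fun g : K → K => g ∘ f :=
    continuous_pi fun k => continuous_apply (f k)
  obtain ⟨_, ⟨g, hg, rfl⟩, hidem⟩ := exists_idempotent_in_compact_subsemigroup hcomp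
    ((· ∘ f) '' envelopingSemigroup H K) ⟨_, f, hf, rfl⟩
    (isClosed_closure.isCompact.image (hcomp f)) <| by
      rintro _ ⟨a, ha, rfl⟩ _ ⟨b, hb, rfl⟩
      exact ⟨a ∘ f ∘ b,
        comp_mem_envelopingSemigroup ha (comp_mem_envelopingSemigroup hf hb), rfl⟩
  exact ⟨g, hg, eq_id_of_comp_self_eq hdistal (comp_mem_envelopingSemigroup hg hf) hidem⟩

/-- The enveloping semigroup of a distal action on a compact Hausdorff space is a group. -/
theorem exists_rightInverse_mem_envelopingSemigroup (hdistal : ∀ k : K, IsDistalPoint H k)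
    {f : K → K} (hf : f ∈ envelopingSemigroup H K) :
    ∃ g ∈ envelopingSemigroup H K, Function.RightInverse g f := by
  obtain ⟨g, hg, hgf⟩ := exists_comp_eq_id hdistal hf
  obtain ⟨f', -, hf'g⟩ := exists_comp_eq_id hdistal hg
  have hff' : f' = f :=
    Function.LeftInverse.eq_rightInverse (congrFun hf'g) (congrFun hgf)
  exact ⟨g, hg, fun k => hff' ▸ congrFun hf'g k⟩

end EnvelopingSemigroup

section Subaction

variable {H X : Type*} [Group H] [TopologicalSpace X] [MulAction H X]

theorem IsDistalPoint.of_coe {S : SubMulAction H X} {a : S}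
    (ha : IsDistalPoint H (a : X)) : IsDistalPoint H a := by
  rintro b ⟨c, hc⟩
  refine Subtype.ext (ha b ⟨c, ?_⟩)
  refine map_mem_closure (f := fun p : S × S => ((p.1 : X), (p.2 : X))) (by fun_prop) hc ?_
  rintro _ ⟨h, rfl⟩
  exact ⟨h, rfl⟩

/-- If an orbit accumulates at a point `z` of a compact invariant set of distal points, then the
orbit lies in that set and conversely the orbit of `z` accumulates at its base point. -/
theorem mem_and_mem_closure_orbit_of_isDistalPoint [T2Space X] [ContinuousConstSMul H X]
    (S : SubMulAction H X) (hS : IsCompact (S : Set X)) (hdistal : ∀ s ∈ S, IsDistalPoint H s)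
    {y z : X} (hz : z ∈ S) (hzy : z ∈ closure (MulAction.orbit H y)) :
    y ∈ S ∧ y ∈ closure (MulAction.orbit H z) := by
  have : CompactSpace S := isCompact_iff_compactSpace.mp hS
  have : ContinuousConstSMul H S :=
    ⟨fun h => ((continuous_const_smul h).comp continuous_subtype_val).subtype_mk _⟩
  have : (comap (fun h : H => h • y) (𝓝 z)).NeBot := by
    refine comap_neBot_iff.mpr fun t ht => ?_
    obtain ⟨_, hmem, h, rfl⟩ := mem_closure_iff_nhds.mp hzy t ht
    exact ⟨h, hmem⟩
  let U : Ultrafilter H := Ultrafilter.of (comap (fun h : H => h • y) (𝓝 z))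
  have hUy : Tendsto (fun h : H => h • y) U (𝓝 z) :=
    tendsto_comap.mono_left (Ultrafilter.of_le _)
  let e : H → S → S := fun h s => h • s
  obtain ⟨f, -, hUf⟩ := isCompact_univ.ultrafilter_le_nhds (U.map e) (by simp)
  have hUf : Tendsto e U (𝓝 f) := hUf
  have hf : f ∈ envelopingSemigroup H S :=
    mem_closure_of_tendsto hUf (Eventually.of_forall mem_range_self)
  obtain ⟨g, hg, hfg⟩ := exists_rightInverse_mem_envelopingSemigroup
    (fun s : S => (hdistal s s.2).of_coe) hf
  let w : S := g ⟨z, hz⟩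
  have hUw : Tendsto (fun h : H => h • (w : X)) U (𝓝 z) := by
    have hUfw := (continuous_subtype_val.tendsto _).comp (tendsto_pi_nhds.mp hUf w)
    rwa [hfg ⟨z, hz⟩] at hUfw
  have hyw : y = w := hdistal w w.2 y
    ⟨z, mem_closure_of_tendsto (hUw.prodMk_nhds hUy) (Eventually.of_forall fun h => ⟨h, rfl⟩)⟩
  rw [hyw]
  refine ⟨w.2, map_mem_closure continuous_subtype_val (apply_mem_closure_orbit_s11 hg _) ?_⟩
  rintro _ ⟨h, rfl⟩
  exact ⟨h, rfl⟩

end Subaction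

/-- Lemma 3.4: if `H` acts by homeomorphisms on a Hausdorff space `X` and `closure (H x)` is
compact and consists of distal points, then `H` acts minimally on `closure (H x)`; indeed
`closure (H y) = closure (H x)` whenever the two orbit closures meet. -/
theorem distal_orbit_closure_minimal {H : Type*} {X : Type*} [Group H] [TopologicalSpace X]
    [T2Space X] [MulAction H X]
    (hcont : ∀ h : H, Continuous fun x : X => h • x)
    (x : X)
    (hcpt : IsCompact (closure (MulAction.orbit H x)))
    (hdistal : ∀ y ∈ closure (MulAction.orbit H x), IsDistalPoint H y) :
    (∀ z ∈ closure (MulAction.orbit H x),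
        closure (MulAction.orbit H x) ⊆ closure (MulAction.orbit H z)) ∧
      ∀ y : X, (closure (MulAction.orbit H x) ∩ closure (MulAction.orbit H y)).Nonempty →
        closure (MulAction.orbit H y) = closure (MulAction.orbit H x) := by
  have : ContinuousConstSMul H X := ⟨hcont⟩
  have orbit_closure_subset {a b : X} (ha : a ∈ closure (MulAction.orbit H b)) :
      closure (MulAction.orbit H a) ⊆ closure (MulAction.orbit H b) := by
    refine closure_minimal ?_ isClosed_closure
    rintro _ ⟨h, rfl⟩
    exact smul_closure_orbit_subset h b (smul_mem_smul_set ha)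
  let S : SubMulAction H X :=
    { carrier := closure (MulAction.orbit H x)
      smul_mem' := fun h _ ha => smul_closure_orbit_subset h x (smul_mem_smul_set ha) }
  have hminimal (z : X) (hz : z ∈ closure (MulAction.orbit H x)) :
      closure (MulAction.orbit H x) ⊆ closure (MulAction.orbit H z) :=
    orbit_closure_subset (mem_and_mem_closure_orbit_of_isDistalPoint S hcpt hdistal hz hz).2
  refine ⟨hminimal, fun y ⟨z, hzx, hzy⟩ => ?_⟩
  have hy : y ∈ closure (MulAction.orbit H x) :=
    (mem_and_mem_closure_orbit_of_isDistalPoint S hcpt hdistal hzx hzy).1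
  exact (orbit_closure_subset hy).antisymm (hminimal y hy)

end Reid
end

section
/- Let G be a group, let S ⊆ G with 1 ∈ S and S = S⁻¹ and ⟨S⟩ = G, and let F be a finite subset of G. Then there is a positive integer n such that for all g ∈ G with |g| ≥ n, there exists c ∈ G with |c| = n and Fc ⊆ K(g). -/
open Filter Topology Set Pointwise Uniformity

namespace Reid

theorem exists_mem_pow_of_closure_eq_top {G : Type*} [Group G] {S : Set G}
    (hSinv : S⁻¹ = S) (hSgen : Subgroup.closure S = ⊤) (g : G) : ∃ n : ℕ, g ∈ S ^ n := by
  have hg : g ∈ Subgroup.closure S := hSgen ▸ Subgroup.mem_top g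
  induction hg using Subgroup.closure_induction with
  | mem x hx => exact ⟨1, by simpa using hx⟩
  | one => exact ⟨0, by simp⟩
  | mul x y _ _ hx hy =>
    obtain ⟨a, ha⟩ := hx
    obtain ⟨b, hb⟩ := hy
    exact ⟨a + b, pow_add S a b ▸ Set.mul_mem_mul ha hb⟩
  | inv x _ hx =>
    obtain ⟨a, ha⟩ := hx
    refine ⟨a, ?_⟩
    rw [← hSinv, inv_pow]
    exact Set.inv_mem_inv.2 ha

/-- Lemma 3.6: if `S ⊆ G` with `1 ∈ S = S⁻¹` and `⟨S⟩ = G`, and `F ⊆ G` is finite, then there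
is a positive integer `n` such that for every `g ∈ G` with `|g| ≥ n` there is `c ∈ G` with
`|c| = n` and `F c ⊆ K(g)`. -/
theorem exists_translate_in_Kset {G : Type*} [Group G] (S : Set G)
    (hS1 : 1 ∈ S) (hSinv : S⁻¹ = S) (hSgen : Subgroup.closure S = ⊤)
    (F : Finset G) :
    ∃ n : ℕ, 0 < n ∧ ∀ g : G, n ≤ wordLen S g →
      ∃ c : G, wordLen S c = n ∧ ∀ f ∈ F, f * c ∈ Kset S g := by
  have hgen := exists_mem_pow_of_closure_eq_top hSinv hSgen
  choose k hk using hgen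
  refine ⟨F.sup k + 1, Nat.succ_pos _, fun g hg => ?_⟩
  have hgmem : g ∈ S ^ wordLen S g := Nat.sInf_mem (s := {n | g ∈ S ^ n}) ⟨k g, hk g⟩
  obtain ⟨d, hd⟩ := Nat.exists_eq_add_of_le' hg
  rw [hd, pow_add] at hgmem
  obtain ⟨h, hh, c, hc, rfl⟩ := Set.mem_mul.1 hgmem
  refine ⟨c, le_antisymm (Nat.sInf_le hc) ?_, fun f hf => ?_⟩
  · have hc' : c ∈ S ^ wordLen S c := Nat.sInf_mem (s := {n | c ∈ S ^ n}) ⟨_, hc⟩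
    have hle : wordLen S (h * c) ≤ d + wordLen S c :=
      Nat.sInf_le (show h * c ∈ S ^ (d + wordLen S c) from
        pow_add S d _ ▸ Set.mul_mem_mul hh hc')
    omega
  · have hf' : f ∈ S ^ F.sup k := Set.pow_subset_pow_right hS1 (Finset.le_sup hf) (hk f)
    have hinv : h⁻¹ ∈ S ^ d := by
      rw [← hSinv, inv_pow]
      exact Set.inv_mem_inv.2 hh
    refine Set.mem_mul.2 ⟨f * h⁻¹, ?_, h * c, rfl, by group⟩
    rw [hd, show d + (F.sup k + 1) - 1 = F.sup k + d by omega, pow_add]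
    exact Set.mul_mem_mul hf' hinv

end Reid
end

section
/- Let X be a locally compact Hausdorff space, let G be a group of homeomorphisms of X, and let R ⊆ X × X be the G-orbit closure relation. Suppose that there is a G-equivariant quotient map φ: X → Y, where Y is a locally compact Hausdorff space such that G acts trivially on Y and minimally on each fibre of φ. Then R is closed in X × X. -/
open Filter Topology Set Pointwise Uniformity

namespace Reid

/-- Proposition 3.7(i): if there is a `G`-equivariant quotient map `φ : X → Y` onto a locally
compact Hausdorff space on which `G` acts trivially, with `G` acting minimally on each fibre,
then the orbit closure relation is closed. -/
theorem orbit_closure_relation_closed_of_quotient {X Y : Type*} [TopologicalSpace X] [T2Space X]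
    [LocallyCompactSpace X] [TopologicalSpace Y] [T2Space Y] [LocallyCompactSpace Y]
    (G : Subgroup (X ≃ₜ X)) (φ : X → Y) (hφ : Topology.IsQuotientMap φ)
    (hequiv : ∀ g ∈ G, ∀ x : X, φ ((g : X ≃ₜ X) x) = φ x)
    (hmin : ∀ x y : X, φ x = φ y → y ∈ closure (MulAction.orbit G x)) :
    IsClosed {p : X × X | p.2 ∈ closure (MulAction.orbit G p.1)} := by
  have hR : {p : X × X | p.2 ∈ closure (MulAction.orbit G p.1)} = {p | φ p.1 = φ p.2} := by
    ext ⟨x, y⟩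
    refine ⟨fun hy => ?_, hmin x y⟩
    have hfibre : IsClosed {z | φ x = φ z} := isClosed_eq continuous_const hφ.continuous
    refine closure_minimal ?_ hfibre hy
    rintro _ ⟨g, rfl⟩
    exact (hequiv g g.2 x).symm
  rw [hR]
  exact isClosed_eq (hφ.continuous.comp continuous_fst) (hφ.continuous.comp continuous_snd)

end Reid
end

section
/- Let X be a locally compact Hausdorff space, let G be a group of homeomorphisms of X, and let R ⊆ X × X be the G-orbit closure relation. If R ∩ (W × W) is closed in W × W for some open subset W ⊆ X, then for all x ∈ X and y ∈ W such that y ∈ closure(Gx), we have x ∈ closure(Gy). -/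
open Filter Topology Set Pointwise Uniformity

namespace Reid

/-- Orbit closures are invariant under the group. -/
theorem smul_mem_closure_orbit {X : Type*} [TopologicalSpace X] (G : Subgroup (X ≃ₜ X)) (g : G)
    {x y : X} (h : x ∈ closure (MulAction.orbit G y)) :
    g • x ∈ closure (MulAction.orbit G y) :=
  map_mem_closure (f := fun z : X => g • z) (g : X ≃ₜ X).continuous h fun _ hz =>
    MulAction.mem_orbit_of_mem_orbit g hz

/-- Proposition 3.7(ii): if the orbit closure relation restricted to `W × W` is closed for an
open set `W`, then for all `x ∈ X` and `y ∈ W` with `y ∈ closure (G x)` we have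
`x ∈ closure (G y)`. -/
theorem orbit_closure_symm_of_relatively_closed {X : Type*} [TopologicalSpace X] [T2Space X]
    [LocallyCompactSpace X] (G : Subgroup (X ≃ₜ X)) (W : Set X) (hW : IsOpen W)
    (hclosed : IsClosed {p : ↥W × ↥W | (p.2 : X) ∈ closure (MulAction.orbit G (p.1 : X))}) :
    ∀ x : X, ∀ y ∈ W, y ∈ closure (MulAction.orbit G x) → x ∈ closure (MulAction.orbit G y) := by
  intro x y hy hxy
  obtain ⟨_, hgW, g, rfl⟩ := mem_closure_iff.1 hxy W hW hy
  let x' : W := ⟨g • x, hgW⟩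
  have hslice : IsClosed {z : W | (x' : X) ∈ closure (MulAction.orbit G (z : X))} :=
    hclosed.preimage (f := fun z : W => (z, x')) (by fun_prop)
  have hmem : (⟨y, hy⟩ : W) ∈ closure {z : W | (z : X) ∈ MulAction.orbit G x} := by
    refine mem_closure_iff.2 fun U hU hyU => ?_
    obtain ⟨_, ⟨z, hzU, rfl⟩, hz⟩ := mem_closure_iff.1 hxy _
      (hW.isOpenMap_subtype_val U hU) ⟨_, hyU, rfl⟩
    exact ⟨z, hzU, hz⟩
  have hgx : g • x ∈ closure (MulAction.orbit G y) := by
    refine hslice.closure_subset_iff.2 (fun z hz => subset_closure ?_) hmem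
    rw [MulAction.orbit_eq_iff.2 hz]
    exact MulAction.mem_orbit x g
  simpa using smul_mem_closure_orbit G g⁻¹ hgx

end Reid
end

section
/- Let X be a locally compact zero-dimensional space equipped with a compatible uniformity, let S ⊆ Homeo(X) with 1 ∈ S and S = S⁻¹, let G = ⟨S⟩, and let x ∈ X. Suppose that closure(Gx) is compact and that there is a neighbourhood of closure(Gx) in X consisting of distal points for the action of G. Then the following are equivalent: (i) there is a closed G-invariant neighbourhood U of x consisting of points of equicontinuity for S; (ii) there is a compact G-invariant neighbourhood V of x on which G acts equicontinuously. -/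
open Filter Topology Set Pointwise Uniformity

namespace Reid

section Dynamics

/-- A distal point whose orbit accumulates at a compact invariant set lies in that set. -/
theorem IsDistalPoint.mem_of_isCompact {G Z : Type*} [Group G] [TopologicalSpace Z]
    [RegularSpace Z] [MulAction G Z] [ContinuousConstSMul G Z] {z : Z}
    (hz : IsDistalPoint G z) {C : Set Z} (hC : IsCompact C)
    (hinv : ∀ g : G, ∀ y ∈ C, g • y ∈ C) {w : Z} (hw : w ∈ C)
    (hwz : w ∈ closure (MulAction.orbit G z)) : z ∈ C := by
  let _ := Ultrafilter.semigroup (M := G)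
  let L : Set (Ultrafilter G) :=
    {p | ∀ O : Set Z, IsOpen O → C ⊆ O → ∀ᶠ g in (p : Filter G), g • z ∈ O}
  have hLne : L.Nonempty := by
    have : (comap (fun g : G => g • z) (𝓝 w)).NeBot :=
      comap_neBot_iff.2 fun t ht => by
        obtain ⟨_, hy, g, rfl⟩ := mem_closure_iff_nhds.1 hwz t ht
        exact ⟨g, hy⟩
    refine ⟨Ultrafilter.of (comap (fun g : G => g • z) (𝓝 w)), fun O hO hCO => ?_⟩
    exact Ultrafilter.of_le _ (preimage_mem_comap (hO.mem_nhds (hCO hw)))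
  have hLc : IsCompact L := by
    refine IsClosed.isCompact ?_
    have : L = ⋂ (O : Set Z) (_ : IsOpen O) (_ : C ⊆ O),
        {p : Ultrafilter G | {g : G | g • z ∈ O} ∈ p} := by
      ext p; simp [L]; rfl
    rw [this]
    exact isClosed_iInter fun O => isClosed_iInter fun _ => isClosed_iInter fun _ =>
      ultrafilter_isClosed_basic _
  obtain ⟨e, heL, hee⟩ := exists_idempotent_in_compact_subsemigroup
    Ultrafilter.continuous_mul_left L hLne hLc (by
      intro p hp q hq O hO hCO
      rw [Ultrafilter.eventually_mul]
      refine Eventually.of_forall fun a => ?_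
      have := hq ((a • ·) ⁻¹' O) (hO.preimage (continuous_const_smul a))
        fun y hy => hCO (hinv a y hy)
      simpa [mul_smul] using this)
  obtain ⟨v, hvC, hv⟩ : ∃ v ∈ C, Tendsto (fun g : G => g • z) e (𝓝 v) := by
    by_contra! h
    have h' : ∀ v ∈ C, ∃ O : Set Z, v ∈ O ∧ IsOpen O ∧ ∀ᶠ g in (e : Filter G), g • z ∉ O := by
      intro v hv
      have := h v hv
      rw [(nhds_basis_opens v).tendsto_right_iff] at this
      push Not at this
      obtain ⟨O, ⟨hvO, hO⟩, hn⟩ := this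
      exact ⟨O, hvO, hO, hn⟩
    choose! O hvO hO hn using h'
    obtain ⟨t, htC, hCt⟩ := hC.elim_nhds_subcover O fun v hv => (hO v hv).mem_nhds (hvO v hv)
    have h1 := heL (⋃ v ∈ t, O v) (isOpen_biUnion fun v hv => hO v (htC v hv)) hCt
    have h2 : ∀ᶠ g in (e : Filter G), ∀ v ∈ t, g • z ∉ O v :=
      (eventually_all_finset t).2 fun v hv => hn v (htC v hv)
    obtain ⟨g, hg1, hg2⟩ := (h1.and h2).exists
    simp only [mem_iUnion] at hg1
    obtain ⟨v, hvt, hgv⟩ := hg1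
    exact hg2 v hvt hgv
  have hvv : Tendsto (fun g : G => g • v) e (𝓝 v) := by
    rw [(closed_nhds_basis v).tendsto_right_iff]
    rintro O ⟨hO, hOc⟩
    have h1 : ∀ᶠ g in ((e * e : Ultrafilter G) : Filter G), g • z ∈ O := by
      rw [hee]; exact hv hO
    rw [Ultrafilter.eventually_mul] at h1
    filter_upwards [h1] with a ha
    refine hOc.mem_of_tendsto (((continuous_const_smul a).tendsto v).comp hv) ?_
    simpa [mul_smul] using ha
  have hprox : IsProximalPair G z v :=
    ⟨v, mem_closure_of_tendsto (hv.prodMk_nhds hvv) (Eventually.of_forall fun g => ⟨g, rfl⟩)⟩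
  rwa [← hz v hprox]

theorem IsDistalPoint.prodMk {G X Y : Type*} [Group G] [TopologicalSpace X] [TopologicalSpace Y]
    [MulAction G X] [MulAction G Y] {x : X} {y : Y} (hx : IsDistalPoint G x)
    (hy : IsDistalPoint G y) : IsDistalPoint G (x, y) := by
  rintro ⟨a, b⟩ ⟨⟨u, v⟩, h⟩
  refine Prod.ext (hx a ⟨u, ?_⟩) (hy b ⟨v, ?_⟩)
  · refine map_mem_closure (f := fun p : (X × Y) × (X × Y) => (p.1.1, p.2.1))
      (by fun_prop) h ?_
    rintro _ ⟨g, rfl⟩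
    exact ⟨g, rfl⟩
  · refine map_mem_closure (f := fun p : (X × Y) × (X × Y) => (p.1.2, p.2.2))
      (by fun_prop) h ?_
    rintro _ ⟨g, rfl⟩
    exact ⟨g, rfl⟩

theorem mem_iff_mem_uniformity {Z : Type*} [UniformSpace Z] {B : Set Z} (hB : IsCompact B)
    (hBo : IsOpen B) : {p : Z × Z | p.1 ∈ B ↔ p.2 ∈ B} ∈ 𝓤 Z := by
  obtain ⟨V, hV, -, hVB⟩ := lebesgue_number_of_compact_open hB hBo subset_rfl
  filter_upwards [hV, symm_le_uniformity hV] with p h1 h2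
  exact ⟨fun h => hVB _ h h1, fun h => hVB _ h h2⟩

theorem isClopen_of_eventually_mem_iff {Z : Type*} [TopologicalSpace Z] {A T : Set Z}
    (hA : IsClopen A) (hTA : T ⊆ A) (h : ∀ y ∈ A, ∀ᶠ z in 𝓝 y, z ∈ A → (y ∈ T ↔ z ∈ T)) :
    IsClopen T := by
  refine ⟨⟨isOpen_iff_mem_nhds.2 fun y hy => ?_⟩, isOpen_iff_mem_nhds.2 fun y hy => ?_⟩
  · by_cases hyA : y ∈ A
    · filter_upwards [h y hyA] with z hz hzT
      exact hy ((hz (hTA hzT)).2 hzT)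
    · filter_upwards [hA.1.isOpen_compl.mem_nhds hyA] with z hz hzT
      exact hz (hTA hzT)
  · filter_upwards [h y (hTA hy), hA.2.mem_nhds (hTA hy)] with z hz hzA
    exact (hz hzA).1 hy

/-- The points of `A` all of whose `S`-translates lie in `B`. -/
def allIn {G Z : Type*} [SMul G Z] (S : Set G) (A B : Set Z) : Set Z :=
  {y ∈ A | ∀ s ∈ S, s • y ∈ B}

/-- The points of `A` with some `S`-translate in `B`. -/
def someIn {G Z : Type*} [SMul G Z] (S : Set G) (A B : Set Z) : Set Z :=
  {y ∈ A | ∃ s ∈ S, s • y ∈ B}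

variable {G Z : Type*} [Group G] [MulAction G Z] {S : Set G} {A B : Set Z}

theorem iterate_someIn_mono (n : ℕ) {B' : Set Z} (h : B ⊆ B') :
    (someIn S A)^[n] B ⊆ (someIn S A)^[n] B' := by
  refine Monotone.iterate (f := someIn S A) ?_ n h
  exact fun P Q hPQ y hy => ⟨hy.1, hy.2.imp fun s hs => ⟨hs.1, hPQ hs.2⟩⟩

theorem iterate_allIn_subset (n : ℕ) : (allIn S A)^[n] A ⊆ A := by
  cases n with
  | zero => exact subset_rfl
  | succ n => rw [Function.iterate_succ_apply']; exact sep_subset _ _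

theorem iterate_allIn_succ_subset (hS1 : 1 ∈ S) (n : ℕ) :
    (allIn S A)^[n + 1] A ⊆ (allIn S A)^[n] A := by
  rw [Function.iterate_succ_apply']
  intro y hy
  simpa using hy.2 1 hS1

theorem someIn_iterate_allIn_subset (hSinv : ∀ s ∈ S, s⁻¹ ∈ S) (n : ℕ) :
    someIn S A ((allIn S A)^[n + 1] A) ⊆ (allIn S A)^[n] A := by
  rw [Function.iterate_succ_apply']
  rintro y ⟨-, s, hs, -, h⟩
  simpa using h s⁻¹ (hSinv s hs)

theorem subset_iterate_allIn_succ (hSinv : ∀ s ∈ S, s⁻¹ ∈ S) (m : ℕ) :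
    ∀ B : Set Z, B ⊆ (allIn S A)^[m] A → (someIn S A)^[m] B ⊆ allIn S A A →
      B ⊆ (allIn S A)^[m + 1] A := by
  induction m with
  | zero => exact fun B _ h => h
  | succ m ih =>
    intro B hB h
    have hmono : Monotone (someIn S A) := fun _ _ => iterate_someIn_mono 1
    have h1 : someIn S A B ⊆ (allIn S A)^[m + 1] A :=
      ih _ ((hmono hB).trans (someIn_iterate_allIn_subset hSinv m)) h
    intro y hy
    rw [Function.iterate_succ_apply']
    refine ⟨iterate_allIn_subset _ (hB hy), fun s hs => h1 ⟨?_, s⁻¹, hSinv s hs, by simpa⟩⟩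
    have := hB hy
    rw [Function.iterate_succ_apply'] at this
    exact iterate_allIn_subset _ (this.2 s hs)

theorem smul_mem_of_closure_eq_top (hgen : Subgroup.closure S = ⊤) (hSinv : ∀ s ∈ S, s⁻¹ ∈ S)
    (hB : ∀ s ∈ S, ∀ y ∈ B, s • y ∈ B) (g : G) : ∀ y ∈ B, g • y ∈ B := by
  have hg : g ∈ Subgroup.closure S := hgen ▸ Subgroup.mem_top g
  induction hg using Subgroup.closure_induction'' with
  | mem s hs => exact hB s hs
  | inv_mem s hs => exact hB _ (hSinv s hs)
  | one => simp
  | mul a b _ _ ha hb => exact fun y hy => mul_smul a b y ▸ ha _ (hb y hy)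

variable [UniformSpace Z]

theorem eventually_smul_mem_iff_s18 {y : Z}
    (hy : ∀ E ∈ 𝓤 Z, ∀ᶠ z in 𝓝 y, ∀ s ∈ S, (s • y, s • z) ∈ E) (hB : IsCompact B)
    (hBo : IsOpen B) : ∀ᶠ z in 𝓝 y, ∀ s ∈ S, (s • y ∈ B ↔ s • z ∈ B) :=
  hy _ (mem_iff_mem_uniformity hB hBo)

theorem isClopen_allIn (hA : IsClopen A)
    (hS : ∀ y ∈ A, ∀ E ∈ 𝓤 Z, ∀ᶠ z in 𝓝 y, ∀ s ∈ S, (s • y, s • z) ∈ E)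
    (hB : IsCompact B) (hBo : IsOpen B) : IsClopen (allIn S A B) := by
  refine isClopen_of_eventually_mem_iff hA (sep_subset _ _) fun y hy => ?_
  filter_upwards [eventually_smul_mem_iff_s18 (hS y hy) hB hBo] with z hz hzA
  exact ⟨fun h => ⟨hzA, fun s hs => (hz s hs).1 (h.2 s hs)⟩,
    fun h => ⟨hy, fun s hs => (hz s hs).2 (h.2 s hs)⟩⟩

theorem isClopen_someIn (hA : IsClopen A)
    (hS : ∀ y ∈ A, ∀ E ∈ 𝓤 Z, ∀ᶠ z in 𝓝 y, ∀ s ∈ S, (s • y, s • z) ∈ E)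
    (hB : IsCompact B) (hBo : IsOpen B) : IsClopen (someIn S A B) := by
  refine isClopen_of_eventually_mem_iff hA (sep_subset _ _) fun y hy => ?_
  filter_upwards [eventually_smul_mem_iff_s18 (hS y hy) hB hBo] with z hz hzA
  exact ⟨fun h => ⟨hzA, h.2.imp fun s hs => ⟨hs.1, (hz s hs.1).1 hs.2⟩⟩,
    fun h => ⟨hy, h.2.imp fun s hs => ⟨hs.1, (hz s hs.1).2 hs.2⟩⟩⟩

/-- If `S` generates `G` and is equicontinuous at the points of a compact open set `A` consisting
of distal points, then the largest `G`-invariant subset of `A` is clopen. -/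
theorem isClopen_setOf_forall_smul_mem [T2Space Z] [ContinuousConstSMul G Z]
    (hgen : Subgroup.closure S = ⊤) (hS1 : 1 ∈ S) (hSinv : ∀ s ∈ S, s⁻¹ ∈ S)
    (hAc : IsCompact A) (hAo : IsOpen A)
    (hS : ∀ y ∈ A, ∀ E ∈ 𝓤 Z, ∀ᶠ z in 𝓝 y, ∀ s ∈ S, (s • y, s • z) ∈ E)
    (hdist : ∀ y ∈ A, IsDistalPoint G y) : IsClopen {y : Z | ∀ g : G, g • y ∈ A} := by
  have hA : IsClopen A := ⟨hAc.isClosed, hAo⟩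
  have hcl : ∀ n, IsClopen ((allIn S A)^[n] A) := by
    intro n
    induction n with
    | zero => exact hA
    | succ n ih =>
      rw [Function.iterate_succ_apply']
      exact isClopen_allIn hA hS (hAc.of_isClosed_subset ih.1 (iterate_allIn_subset n)) ih.2
  have hco : ∀ n, IsCompact ((allIn S A)^[n] A) := fun n =>
    hAc.of_isClosed_subset (hcl n).1 (iterate_allIn_subset n)
  have hsub : ∀ n y, (∀ g : G, g • y ∈ A) → y ∈ (allIn S A)^[n] A := by
    intro n
    induction n with
    | zero => exact fun y hy => by simpa using hy 1
    | succ n ih =>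
      intro y hy
      rw [Function.iterate_succ_apply']
      exact ⟨by simpa using hy 1, fun s _ => ih _ fun g => by simpa [mul_smul] using hy (g * s)⟩
  by_cases hstab : ∃ n, (allIn S A)^[n] A ⊆ (allIn S A)^[n + 1] A
  · obtain ⟨n, hn⟩ := hstab
    convert hcl n using 1
    refine Subset.antisymm (fun y hy => hsub n y hy) fun y hy g => ?_
    refine iterate_allIn_subset n (smul_mem_of_closure_eq_top hgen hSinv ?_ g y hy)
    intro s hs y hy
    have := hn hy
    rw [Function.iterate_succ_apply'] at this
    exact this.2 s hs
  exfalso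
  let C : Set Z := ⋂ n, (allIn S A)^[n] A
  have hCc : IsCompact C :=
    (hco 0).of_isClosed_subset (isClosed_iInter fun n => (hcl n).1) (iInter_subset _ 0)
  have hCinv : ∀ g : G, ∀ y ∈ C, g • y ∈ C :=
    smul_mem_of_closure_eq_top hgen hSinv fun s hs y hy => mem_iInter.2 fun n => by
      have := mem_iInter.1 hy (n + 1)
      rw [Function.iterate_succ_apply'] at this
      exact this.2 s hs
  have hPcl : ∀ k (B : Set Z), B ⊆ A → IsClopen B →
      (someIn S A)^[k] B ⊆ A ∧ IsClopen ((someIn S A)^[k] B) := by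
    intro k B hBA hB
    induction k with
    | zero => exact ⟨hBA, hB⟩
    | succ k ih =>
      rw [Function.iterate_succ_apply']
      exact ⟨sep_subset _ _,
        isClopen_someIn hA hS (hAc.of_isClosed_subset ih.2.1 ih.1) ih.2.2⟩
  let T : ℕ → Set Z := fun k => (someIn S A)^[k] ((allIn S A)^[k] A) \ allIn S A A
  have hTA : ∀ k, T k ⊆ A := fun k =>
    sdiff_subset.trans (hPcl k _ (iterate_allIn_subset k) (hcl k)).1
  have hTcl : ∀ k, IsClosed (T k) := fun k =>
    ((hPcl k _ (iterate_allIn_subset k) (hcl k)).2.diff (hcl 1)).1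
  obtain ⟨z, hz⟩ : (⋂ k, T k).Nonempty := by
    refine IsCompact.nonempty_iInter_of_sequence_nonempty_isCompact_isClosed T ?_ ?_
      (hAc.of_isClosed_subset (hTcl 0) (hTA 0)) hTcl
    · intro k
      refine sdiff_subset_sdiff_left ?_
      rw [Function.iterate_succ_apply]
      exact iterate_someIn_mono k (someIn_iterate_allIn_subset hSinv k)
    · intro k
      by_contra h
      exact hstab ⟨k, subset_iterate_allIn_succ hSinv k _ subset_rfl
        (sdiff_eq_empty.1 (not_nonempty_iff_eq_empty.1 h))⟩
  have hzT := mem_iInter.1 hz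
  have horb : ∀ k (B : Set Z) (y : Z), y ∈ (someIn S A)^[k] B → ∃ g : G, g • y ∈ B := by
    intro k B
    induction k with
    | zero => exact fun y hy => ⟨1, by simpa using hy⟩
    | succ k ih =>
      intro y hy
      rw [Function.iterate_succ_apply'] at hy
      obtain ⟨-, s, -, hs⟩ := hy
      obtain ⟨g, hg⟩ := ih _ hs
      exact ⟨g * s, by rwa [mul_smul]⟩
  obtain ⟨w, hw⟩ : (⋂ k, (allIn S A)^[k] A ∩ closure (MulAction.orbit G z)).Nonempty := by
    refine IsCompact.nonempty_iInter_of_sequence_nonempty_isCompact_isClosed _ ?_ ?_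
      ((hco 0).inter_right isClosed_closure) fun k => (hcl k).1.inter isClosed_closure
    · exact fun k => inter_subset_inter_left _ (iterate_allIn_succ_subset hS1 k)
    · intro k
      obtain ⟨g, hg⟩ := horb k _ z (hzT k).1
      exact ⟨g • z, hg, subset_closure ⟨g, rfl⟩⟩
  have hw' := mem_iInter.1 hw
  have hzC : z ∈ C := (hdist z (hTA 0 (hzT 0))).mem_of_isCompact hCc hCinv
    (mem_iInter.2 fun k => (hw' k).1) (hw' 0).2
  exact (hzT 0).2 (mem_iInter.1 hzC 1)

end Dynamics

theorem ZeroDimensional.exists_isCompact_isClopen {X : Type*} [TopologicalSpace X] [T2Space X]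
    [LocallyCompactSpace X] (hzd : ZeroDimensional X) {K O : Set X} (hK : IsCompact K)
    (hO : IsOpen O) (hKO : K ⊆ O) : ∃ A, IsCompact A ∧ IsOpen A ∧ K ⊆ A ∧ A ⊆ O := by
  obtain ⟨B, hB, hBc⟩ := hzd
  have h : ∀ y ∈ K, ∃ P : Set X, y ∈ P ∧ IsCompact P ∧ IsOpen P ∧ P ⊆ O := by
    intro y hy
    obtain ⟨L, hL, hLO, hLc⟩ := local_compact_nhds (hO.mem_nhds (hKO hy))
    obtain ⟨P, hP, hyP, hPL⟩ := hB.mem_nhds_iff.1 hL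
    exact ⟨P, hyP, hLc.of_isClosed_subset (hBc P hP).1 hPL, (hBc P hP).2, hPL.trans hLO⟩
  choose! P hyP hPc hPo hPO using h
  obtain ⟨t, htK, hKt⟩ := hK.elim_nhds_subcover P fun y hy => (hPo y hy).mem_nhds (hyP y hy)
  exact ⟨⋃ y ∈ t, P y, t.isCompact_biUnion fun y hy => hPc y (htK y hy),
    isOpen_biUnion fun y hy => hPo y (htK y hy), hKt, iUnion₂_subset fun y hy => hPO y (htK y hy)⟩

theorem ZeroDimensional.prod {X Y : Type*} [TopologicalSpace X] [TopologicalSpace Y]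
    (hX : ZeroDimensional X) (hY : ZeroDimensional Y) : ZeroDimensional (X × Y) := by
  obtain ⟨B, hB, hBc⟩ := hX
  obtain ⟨B', hB', hBc'⟩ := hY
  refine ⟨_, hB.prod hB', ?_⟩
  rintro _ ⟨P, hP, Q, hQ, rfl⟩
  exact (hBc P hP).prod (hBc' Q hQ)

theorem image_eq_of_forall_mem {X : Type*} [TopologicalSpace X] {G : Subgroup (X ≃ₜ X)}
    {U : Set X} (h : ∀ g ∈ G, ∀ y ∈ U, g y ∈ U) : ∀ g ∈ G, g '' U = U := by
  intro g hg
  refine Subset.antisymm (image_subset_iff.2 (h g hg)) fun y hy => ?_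
  exact ⟨g⁻¹ y, h _ (G.inv_mem hg) y hy, g.apply_symm_apply y⟩

theorem exists_isClosed_nhds_subset_interior {X : Type*} [UniformSpace X] [T2Space X]
    {G : Subgroup (X ≃ₜ X)} {x : X} {V : Set X} (hV : IsClosed V) (hVx : V ∈ 𝓝 x)
    (hVinv : ∀ g ∈ G, (g : X ≃ₜ X) '' V = V)
    (hVeq : ∀ y ∈ V, ∀ E ∈ 𝓤 X, ∃ N ∈ 𝓝 y, ∀ g ∈ G, ∀ z ∈ N ∩ V,
      ((g : X ≃ₜ X) y, (g : X ≃ₜ X) z) ∈ E) :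
    ∃ U : Set X, IsClosed U ∧ U ∈ 𝓝 x ∧ (∀ g ∈ G, (g : X ≃ₜ X) '' U = U) ∧ U ⊆ interior V := by
  obtain ⟨E, hE, hEV⟩ := UniformSpace.mem_nhds_iff.1 (interior_mem_nhds.2 hVx)
  obtain ⟨F, hF, hFs, hFE⟩ := comp_symm_mem_uniformity_sets hE
  let M : Set X := {y | ∃ g ∈ G, (g : X ≃ₜ X) y ∈ UniformSpace.ball x F ∩ V}
  have hMV : M ⊆ V := by
    rintro y ⟨g, hg, -, hy⟩
    rw [← hVinv g hg] at hy
    obtain ⟨z, hz, hzy⟩ := hy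
    rwa [← g.injective hzy]
  have hMinv : ∀ g ∈ G, (g : X ≃ₜ X) '' M = M := by
    refine image_eq_of_forall_mem ?_
    rintro g hg y ⟨h, hh, hy⟩
    refine ⟨h * g⁻¹, G.mul_mem hh (G.inv_mem hg), ?_⟩
    have : (h * g⁻¹) (g y) = h y := congrArg h (g.symm_apply_apply y)
    rwa [this]
  refine ⟨closure M, isClosed_closure, ?_, ?_, ?_⟩
  · refine mem_of_superset (inter_mem (UniformSpace.ball_mem_nhds x hF) hVx)
      (Subset.trans ?_ subset_closure)
    exact fun y hy => ⟨1, G.one_mem, hy⟩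
  · intro g hg
    rw [g.image_closure, hMinv g hg]
  · intro z hz
    have hzV : z ∈ V := closure_minimal hMV hV hz
    obtain ⟨N, hN, hNF⟩ := hVeq z hzV F hF
    obtain ⟨y, hyN, hyM⟩ := mem_closure_iff_nhds.1 hz N hN
    have ⟨g, hg, hgF, _⟩ := hyM
    have h1 : (g z, g y) ∈ F := hNF g hg y ⟨hyN, hMV hyM⟩
    have h2 : g z ∈ interior V := hEV (hFE ⟨g y, hgF, hFs.symm _ _ h1⟩)
    rw [← hVinv g hg, ← g.image_interior] at h2
    obtain ⟨z', hz', hzz⟩ := h2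
    rwa [← g.injective hzz]

/-- Corollary 3.9: suppose `X` is locally compact zero-dimensional with a compatible uniformity,
`1 ∈ S = S⁻¹`, `G = ⟨S⟩`, `closure (G x)` is compact, and some neighbourhood of `closure (G x)`
consists of distal points for `G`.  Then there is a closed `G`-invariant neighbourhood of `x`
consisting of points of equicontinuity for `S` if and only if there is a compact `G`-invariant
neighbourhood of `x` on which `G` acts equicontinuously. -/
theorem distal_equicontinuous_nbhd_iff {X : Type*} [UniformSpace X] [T2Space X]
    [LocallyCompactSpace X] (hzd : ZeroDimensional X)
    (S : Set (X ≃ₜ X)) (hS1 : 1 ∈ S) (hSinv : S⁻¹ = S)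
    (G : Subgroup (X ≃ₜ X)) (hSgen : Subgroup.closure S = G) (x : X)
    (hcpt : IsCompact (closure (MulAction.orbit G x)))
    (hdist : ∃ U' : Set X, (∀ y ∈ closure (MulAction.orbit G x), U' ∈ 𝓝 y) ∧
      ∀ y ∈ U', IsDistalPoint (↥G) y) :
    (∃ U : Set X, IsClosed U ∧ U ∈ 𝓝 x ∧ (∀ g ∈ G, (g : X ≃ₜ X) '' U = U) ∧
        ∀ y ∈ U, EquicontinuousAtPt ‹UniformSpace X› S y) ↔
      (∃ V : Set X, IsCompact V ∧ V ∈ 𝓝 x ∧ (∀ g ∈ G, (g : X ≃ₜ X) '' V = V) ∧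
        ∀ y ∈ V, ∀ E ∈ 𝓤 X, ∃ N ∈ 𝓝 y, ∀ g ∈ G, ∀ z ∈ N ∩ V,
          ((g : X ≃ₜ X) y, (g : X ≃ₜ X) z) ∈ E) := by
  constructor
  · rintro ⟨Y, hYc, hYx, hYinv, hYeq⟩
    obtain ⟨U', hU'n, hU'd⟩ := hdist
    have hcont : ContinuousConstSMul G X := ⟨fun g => g.1.continuous⟩
    let K := closure (MulAction.orbit G x)
    have hinvcl : ∀ y : X, ∀ g : G, ∀ z ∈ closure (MulAction.orbit G y),
        g • z ∈ closure (MulAction.orbit G y) := by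
      intro y g z hz
      refine map_mem_closure (continuous_const_smul g) hz ?_
      rintro _ ⟨h, rfl⟩
      exact ⟨g * h, mul_smul g h y⟩
    have hxK : x ∈ K := subset_closure (MulAction.mem_orbit_self x)
    have hYfr : ∀ g : G, ∀ y ∈ interior Y, g • y ∈ interior Y := by
      intro g y hy
      rw [← hYinv g.1 g.2, ← g.1.image_interior]
      exact ⟨y, hy, rfl⟩
    have hKY : K ⊆ interior Y := by
      intro k hk
      by_contra hkY
      have hsub : closure (MulAction.orbit G k) ⊆ (interior Y)ᶜ := by
        refine closure_minimal ?_ isOpen_interior.isClosed_compl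
        rintro _ ⟨g, rfl⟩ hg
        exact hkY (by simpa using hYfr g⁻¹ _ hg)
      have hsubK : closure (MulAction.orbit G k) ⊆ K := by
        refine closure_minimal ?_ isClosed_closure
        rintro _ ⟨g, rfl⟩
        exact hinvcl x g k hk
      have hx := (hU'd x (mem_of_mem_nhds (hU'n x hxK))).mem_of_isCompact
        (hcpt.of_isClosed_subset isClosed_closure hsubK) (hinvcl k)
        (subset_closure (MulAction.mem_orbit_self k)) hk
      exact hsub hx (mem_interior_iff_mem_nhds.2 hYx)
    obtain ⟨A, hAc, hAo, hKA, hAO⟩ := hzd.exists_isCompact_isClopen hcpt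
      (isOpen_interior.inter isOpen_interior) (fun k hk =>
        (⟨hKY hk, mem_interior_iff_mem_nhds.2 (hU'n k hk)⟩ : k ∈ interior Y ∩ interior U'))
    let T : Set G := Subtype.val ⁻¹' S
    have hSG : S ⊆ G := hSgen ▸ Subgroup.subset_closure
    have hTgen : Subgroup.closure T = ⊤ := by
      subst hSgen
      exact Subgroup.closure_closure_coe_preimage
    have hT1 : 1 ∈ T := hS1
    have hTinv : ∀ s ∈ T, s⁻¹ ∈ T := fun s hs => by
      have : (s : X ≃ₜ X)⁻¹ ∈ S⁻¹ := Set.inv_mem_inv.2 hs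
      rwa [hSinv] at this
    have hTeq : ∀ y ∈ A, ∀ E ∈ 𝓤 X, ∀ᶠ z in 𝓝 y, ∀ s ∈ T, (s • y, s • z) ∈ E := by
      intro y hy E hE
      obtain ⟨N, hN, h⟩ := hYeq y (interior_subset (hAO hy).1) E hE
      filter_upwards [hN] with z hz s hs
      exact h s hs z hz
    have hAd : ∀ y ∈ A, IsDistalPoint G y := fun y hy => hU'd y (interior_subset (hAO hy).2)
    let V : Set X := {y | ∀ g : G, g • y ∈ A}
    have hVcl : IsClopen V :=
      isClopen_setOf_forall_smul_mem hTgen hT1 hTinv hAc hAo hTeq hAd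
    have hVA : V ⊆ A := fun y hy => by simpa using hy 1
    have hVc : IsCompact V := hAc.of_isClosed_subset hVcl.1 hVA
    have hVinv : ∀ g : G, ∀ y ∈ V, g • y ∈ V := fun g y hy h => by
      simpa [mul_smul] using hy (h * g)
    have hxV : x ∈ V := fun g => hKA (subset_closure ⟨g, rfl⟩)
    refine ⟨V, hVc, hVcl.2.mem_nhds hxV,
      image_eq_of_forall_mem fun g hg => hVinv ⟨g, hg⟩, fun y hy E hE => ?_⟩
    obtain ⟨D, hDc, hDo, hKD, hDO⟩ := (hzd.prod hzd).exists_isCompact_isClopen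
      (hVc.image (continuous_id.prodMk continuous_id)) (isOpen_interior.inter
        (hVcl.2.prod hVcl.2)) (show _ ⊆ interior E ∩ V ×ˢ V by
        rintro _ ⟨v, hv, rfl⟩
        exact ⟨mem_interior_iff_mem_nhds.2 (nhds_le_uniformity v hE), hv, hv⟩)
    have hDeq : ∀ p ∈ D, ∀ E ∈ 𝓤 (X × X), ∀ᶠ q in 𝓝 p, ∀ s ∈ T, (s • p, s • q) ∈ E := by
      rintro ⟨a, b⟩ hp E hE
      obtain ⟨E₁, hE₁, E₂, hE₂, hEE⟩ := entourageProd_subset hE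
      rw [nhds_prod_eq]
      filter_upwards [(hTeq a (hVA (hDO hp).2.1) E₁ hE₁).prod_mk
        (hTeq b (hVA (hDO hp).2.2) E₂ hE₂)] with q hq s hs
      exact hEE ⟨hq.1 s hs, hq.2 s hs⟩
    have hDcl := isClopen_setOf_forall_smul_mem hTgen hT1 hTinv hDc hDo hDeq fun p hp =>
      (hAd p.1 (hVA (hDO hp).2.1)).prodMk (hAd p.2 (hVA (hDO hp).2.2))
    have hyD : (y, y) ∈ {p : X × X | ∀ g : G, g • p ∈ D} :=
      fun g => hKD ⟨g • y, hVinv g y hy, rfl⟩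
    refine ⟨_, (Continuous.prodMk_right y).continuousAt (hDcl.2.mem_nhds hyD), ?_⟩
    exact fun g hg z hz => interior_subset (hDO (hz.1 ⟨g, hg⟩)).1
  · rintro ⟨V, hVc, hVx, hVinv, hVeq⟩
    obtain ⟨U, hU, hUx, hUinv, hUV⟩ :=
      exists_isClosed_nhds_subset_interior hVc.isClosed hVx hVinv hVeq
    refine ⟨U, hU, hUx, hUinv, fun y hy E hE => ?_⟩
    obtain ⟨N, hN, h⟩ := hVeq y (interior_subset (hUV hy)) E hE
    exact ⟨N ∩ V, inter_mem hN (mem_interior_iff_mem_nhds.1 (hUV hy)),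
      fun s hs z hz => h s (hSgen ▸ Subgroup.subset_closure hs) z hz⟩

end Reid
end
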